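/- arXiv:0707.1505 — 2 statements merged into one kernel-verified Lean document; each statement's English description precedes it below -/
import Mathlib

section
/- There is a constant C > 0 (depending on N, F₀,…,F_N, and a) such that for every ε > 0, the set 𝒫_ε = {p a good rational prime : m_p(φ,P) ≥ ε·log p} has lower logarithmic analytic density at least 1 − C·ε; that is, liminf_{s→1⁺} (s−1)·Σ_{p ∈ 𝒫_ε} (log p)/p^s ≥ 1 − C·ε. -/
open MvPolynomial Filter Topology

noncomputable section

/-- The map on integer vectors induced by the homogeneous polynomials `Fp i`. -/
def Fmap {N : ℕ} (Fp : Fin (N + 1) → MvPolynomial (Fin (N + 1)) ℤ) :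
    (Fin (N + 1) → ℤ) → (Fin (N + 1) → ℤ) :=
  fun b i => MvPolynomial.eval b (Fp i)

/-- A rational prime `p` is good if the reductions of the `Fp i` modulo `p` have no common
zero in an algebraic closure of `𝔽_p` other than the origin. -/
def GoodPrime {N : ℕ} (Fp : Fin (N + 1) → MvPolynomial (Fin (N + 1)) ℤ) (p : ℕ) : Prop :=
  ∃ _ : Fact p.Prime,
    ∀ x : Fin (N + 1) → AlgebraicClosure (ZMod p),
      (∀ i, MvPolynomial.aeval x (Fp i) = 0) → x = 0

/-- The number of distinct points of `ℙ^N(𝔽_p)` represented by the reductions mod `p` of the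
iterates `F^[n](a)`, i.e. the size of the orbit of `P mod p`. -/
def orbitLen {N : ℕ} (Fp : Fin (N + 1) → MvPolynomial (Fin (N + 1)) ℤ)
    (a : Fin (N + 1) → ℤ) (p : ℕ) : ℕ :=
  Set.ncard (Set.range fun n : ℕ =>
    Quotient.mk (MulAction.orbitRel (ZMod p)ˣ (Fin (N + 1) → ZMod p))
      (fun i => (((Fmap Fp)^[n] a) i : ZMod p)))

open ArithmeticFunction.vonMangoldt Complex LSeries in
lemma vM_bounds : ∃ C : ℝ, ∀ x : ℝ, x ∈ Set.Ioc 1 2 →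
    |∑' n : ℕ, ArithmeticFunction.vonMangoldt n / (n : ℝ) ^ x - 1 / (x - 1)| ≤ C := by
  have ha : IsUnit (1 : ZMod 1) := isUnit_one
  have hr : residueClass (1 : ZMod 1) = fun n => ArithmeticFunction.vonMangoldt n := by
    ext n
    simp [residueClass, Set.indicator, eq_iff_true_of_subsingleton]
  have H {x : ℝ} (hx : 1 < x) :
      ∑' n, residueClass (1 : ZMod 1) n / (n : ℝ) ^ x =
        (LFunctionResidueClassAux (1 : ZMod 1) x).re + ((1 : ℕ).totient : ℝ)⁻¹ / (x - 1) := by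
    refine ofReal_injective ?_
    simp only [ofReal_tsum, ofReal_div, ofReal_cpow (Nat.cast_nonneg _), ofReal_natCast,
      ofReal_add, ofReal_inv, ofReal_sub, ofReal_one]
    simp_rw [← LFunctionResidueClassAux_real ha hx,
      eqOn_LFunctionResidueClassAux ha <| Set.mem_ofPred.mpr (ofReal_re x ▸ hx), sub_add_cancel,
      LSeries, term]
    refine tsum_congr fun n ↦ ?_
    split_ifs with hn
    · simp only [hn, residueClass_apply_zero, ofReal_zero, zero_div]
    · rfl
  have : ContinuousOn (fun x : ℝ ↦ (LFunctionResidueClassAux (1 : ZMod 1) x).re) (Set.Icc 1 2) :=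
    continuous_re.continuousOn.comp (t := Set.univ) (continuousOn_LFunctionResidueClassAux _)
      (fun ⦃x⦄ a ↦ trivial) |>.comp continuous_ofReal.continuousOn fun x hx ↦ by
        simpa only [Set.mem_ofPred_eq, ofReal_re] using hx.1
  obtain ⟨C, hC⟩ := isCompact_Icc.exists_bound_of_continuousOn this
  refine ⟨C, fun x hx ↦ ?_⟩
  have h := H hx.1
  rw [hr] at h
  simp only at h
  rw [h]
  simpa using hC x (Set.mem_Icc_of_Ioc hx)

lemma vM_summable {x : ℝ} (hx : 1 < x) :
    Summable fun n : ℕ => ArithmeticFunction.vonMangoldt n / (n : ℝ) ^ x := by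
  have hr : ArithmeticFunction.vonMangoldt.residueClass (1 : ZMod 1) =
      fun n => ArithmeticFunction.vonMangoldt n := by
    ext n
    simp [ArithmeticFunction.vonMangoldt.residueClass, Set.indicator, eq_iff_true_of_subsingleton]
  have := LSeries.summable_real_of_abscissaOfAbsConv_lt <|
        (ArithmeticFunction.vonMangoldt.abscissaOfAbsConv_residueClass_le_one (1 : ZMod 1)).trans_lt
          <| (show ((1 : EReal) < (x : ℝ)) by exact_mod_cast hx)
  rw [hr] at this
  exact this

lemma vM_nonprime_summable :
    Summable fun n : ℕ ↦ (if n.Prime then 0 else ArithmeticFunction.vonMangoldt n) / (n : ℝ) := by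
  have hr : ArithmeticFunction.vonMangoldt.residueClass (1 : ZMod 1) =
      fun n => ArithmeticFunction.vonMangoldt n := by
    ext n
    simp [ArithmeticFunction.vonMangoldt.residueClass, Set.indicator, eq_iff_true_of_subsingleton]
  have := ArithmeticFunction.vonMangoldt.summable_residueClass_non_primes_div (1 : ZMod 1)
  rw [hr] at this
  exact this

lemma ind_le_vM (S : Set ℕ) (hS : ∀ p ∈ S, p.Prime) (x : ℝ) (n : ℕ) :
    S.indicator (fun n : ℕ => Real.log n / (n : ℝ) ^ x) n ≤
      ArithmeticFunction.vonMangoldt n / (n : ℝ) ^ x := by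
  by_cases h : n ∈ S
  · rw [Set.indicator_of_mem h, ArithmeticFunction.vonMangoldt_apply_prime (hS n h)]
  · rw [Set.indicator_of_notMem h]
    have := ArithmeticFunction.vonMangoldt_nonneg (n := n)
    positivity

lemma ind_nonneg (S : Set ℕ) (x : ℝ) (n : ℕ) :
    0 ≤ S.indicator (fun n : ℕ => Real.log n / (n : ℝ) ^ x) n := by
  apply Set.indicator_nonneg
  intro n _
  have := Real.log_natCast_nonneg n
  positivity

lemma ind_summable (S : Set ℕ) (hS : ∀ p ∈ S, p.Prime) {x : ℝ} (hx : 1 < x) :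
    Summable (S.indicator (fun n : ℕ => Real.log n / (n : ℝ) ^ x)) :=
  Summable.of_nonneg_of_le (ind_nonneg S x) (ind_le_vM S hS x) (vM_summable hx)

lemma Ioc_mem : Set.Ioc (1 : ℝ) 2 ∈ 𝓝[>] (1 : ℝ) := Ioc_mem_nhdsGT (by norm_num)

lemma dens_cobdd (S : Set ℕ) (hS : ∀ p ∈ S, p.Prime) :
    (𝓝[>] (1 : ℝ)).IsCoboundedUnder (· ≥ ·) (fun s : ℝ => (s - 1) *
      ∑' p : S, Real.log (p : ℕ) / ((p : ℕ) : ℝ) ^ s) := by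
  obtain ⟨C, hC⟩ := vM_bounds
  apply IsBoundedUnder.isCoboundedUnder_ge
  refine ⟨1 + C, ?_⟩
  rw [eventually_map]
  filter_upwards [Ioc_mem] with x hx
  rw [tsum_subtype S (fun n : ℕ => Real.log n / (n : ℝ) ^ x)]
  have h1 := (ind_summable S hS hx.1).tsum_le_tsum (ind_le_vM S hS x) (vM_summable hx.1)
  have h2 := (abs_le.1 (hC x hx)).2
  have hx0 : 0 < x - 1 := by linarith [hx.1]
  have hC0 : 0 ≤ C := (abs_nonneg _).trans (hC x hx)
  have h3 : (x - 1) * (1 / (x - 1)) = 1 := by field_simp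
  have h4 : (x-1) * C ≤ 1 * C := mul_le_mul_of_nonneg_right (by linarith [hx.2]) hC0
  calc _ ≤ (x - 1) * (1 / (x - 1) + C) := mul_le_mul_of_nonneg_left (by linarith) hx0.le
    _ ≤ _ := by rw [mul_add, h3]; linarith

lemma dens_nonneg (S : Set ℕ) (hS : ∀ p ∈ S, p.Prime) :
    0 ≤ liminf (fun s : ℝ => (s - 1) *
      ∑' p : S, Real.log (p : ℕ) / ((p : ℕ) : ℝ) ^ s) (𝓝[>] (1 : ℝ)) := by
  apply le_liminf_of_le (dens_cobdd S hS)
  filter_upwards [Ioc_mem] with x hx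
  rw [tsum_subtype S (fun n : ℕ => Real.log n / (n : ℝ) ^ x)]
  exact mul_nonneg (by linarith [hx.1]) (tsum_nonneg (ind_nonneg S x))

lemma dens_one (S : Set ℕ) (hS : ∀ p ∈ S, p.Prime)
    (hB : Summable ({p : ℕ | p.Prime ∧ p ∉ S}.indicator (fun n : ℕ => Real.log n / (n : ℝ)))) :
    1 ≤ liminf (fun s : ℝ => (s - 1) *
      ∑' p : S, Real.log (p : ℕ) / ((p : ℕ) : ℝ) ^ s) (𝓝[>] (1 : ℝ)) := by
  obtain ⟨C, hC⟩ := vM_bounds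
  set K := ∑' n, ({p : ℕ | p.Prime ∧ p ∉ S}.indicator (fun n : ℕ => Real.log n / (n : ℝ))) n
  set L := ∑' n : ℕ, (if n.Prime then 0 else ArithmeticFunction.vonMangoldt n) / (n : ℝ)
  have ht : Tendsto (fun s : ℝ => 1 - (s - 1) * (C + K + L)) (𝓝[>] (1 : ℝ)) (𝓝 1) := by
    have : Tendsto (fun s : ℝ => 1 - (s - 1) * (C + K + L)) (𝓝 (1 : ℝ)) (𝓝 (1 - (1 - 1) * (C + K + L))) := by
      apply Continuous.tendsto
      fun_prop
    simp only [sub_self, zero_mul, sub_zero] at this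
    exact this.mono_left nhdsWithin_le_nhds
  refine ht.liminf_eq.symm.le.trans ?_
  refine liminf_le_liminf ?_ ht.isBoundedUnder_ge (dens_cobdd S hS)
  filter_upwards [Ioc_mem] with x hx
  rw [tsum_subtype S (fun n : ℕ => Real.log n / (n : ℝ) ^ x)]
  have hx0 : 0 < x - 1 := by linarith [hx.1]
  have h2 := (abs_le.1 (hC x hx)).1
  have h3 : (x - 1) * (1 / (x - 1)) = 1 := by field_simp
  have hpt (n : ℕ) (y : ℝ) (hy : 0 ≤ y) : y / (n : ℝ) ^ x ≤ y / n := by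
    rcases n.eq_zero_or_pos with rfl | hn
    · rw [Nat.cast_zero, Real.zero_rpow (by linarith)]
    · refine div_le_div_of_nonneg_left hy (mod_cast hn) ?_
      conv_lhs => rw [← Real.rpow_one n]
      exact Real.rpow_le_rpow_of_exponent_le (by norm_cast) hx.1.le
  have h1 : ∑' n : ℕ, ArithmeticFunction.vonMangoldt n / (n : ℝ) ^ x ≤
      ∑' n, S.indicator (fun n : ℕ => Real.log n / (n : ℝ) ^ x) n + K + L := by
    have s1 := ind_summable S hS hx.1
    rw [← s1.tsum_add hB, ← (s1.add hB).tsum_add vM_nonprime_summable]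
    refine (vM_summable hx.1).tsum_le_tsum (fun n => ?_) ((s1.add hB).add vM_nonprime_summable)
    by_cases hp : n.Prime
    · by_cases hn : n ∈ S
      · simp [hp, hn, ArithmeticFunction.vonMangoldt_apply_prime hp]
      · simp only [hp, hn, ArithmeticFunction.vonMangoldt_apply_prime hp, not_false_eq_true, Set.indicator_of_notMem, if_true]
        rw [Set.indicator_of_mem (by exact ⟨hp, hn⟩)]
        simpa using hpt n _ (Real.log_natCast_nonneg n)
    · have hn : n ∉ S := fun h => hp (hS n h)
      rw [Set.indicator_of_notMem hn, Set.indicator_of_notMem (by exact fun h => hp h.1), if_neg hp]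
      simpa using hpt n _ ArithmeticFunction.vonMangoldt_nonneg
  calc 1 - (x - 1) * (C + K + L) = (x - 1) * (1 / (x - 1) - (C + K + L)) := by rw [mul_sub, h3]
    _ ≤ _ := mul_le_mul_of_nonneg_left (by linarith) hx0.le

section GoodCofinite

attribute [local instance] MvPolynomial.algebraMvPolynomial

lemma good_cofinite {N : ℕ} (Fp : Fin (N + 1) → MvPolynomial (Fin (N + 1)) ℤ)
    (hzero : ∀ x : Fin (N + 1) → AlgebraicClosure ℚ,
      (∀ i, MvPolynomial.aeval x (Fp i) = 0) → x = 0) :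
    ∃ D : ℕ, D ≠ 0 ∧ ∀ p : ℕ, p.Prime → ¬ p ∣ D → GoodPrime Fp p := by
  have key : ∀ i, ∃ c : ℤ, c ≠ 0 ∧ ∃ n : ℕ, C c * X i ^ n ∈ Ideal.span (Set.range Fp) := by
    intro i
    have h1 : (X i : MvPolynomial (Fin (N + 1)) ℚ) ∈
        ((Ideal.span (Set.range Fp)).map (algebraMap _ (MvPolynomial (Fin (N + 1)) ℚ))).radical := by
      rw [← vanishingIdeal_zeroLocus_eq_radical (K := AlgebraicClosure ℚ)]
      intro x hx
      have : x = 0 := by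
        apply hzero
        intro j
        have := hx (algebraMap _ _ (Fp j))
          (Ideal.mem_map_of_mem _ (Ideal.subset_span ⟨j, rfl⟩))
        rw [algebraMap_def, aeval_map_algebraMap] at this
        exact this
      simp [this]
    obtain ⟨n, hn⟩ := h1
    have h2 : algebraMap (MvPolynomial (Fin (N + 1)) ℤ) (MvPolynomial (Fin (N + 1)) ℚ) (X i ^ n) ∈
      ((Ideal.span (Set.range Fp)).map (algebraMap _ (MvPolynomial (Fin (N + 1)) ℚ))) := by
      rw [algebraMap_def, map_pow, map_X]
      exact hn
    rw [IsLocalization.algebraMap_mem_map_algebraMap_iff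
      ((nonZeroDivisors ℤ).map (C (σ := Fin (N + 1))))] at h2
    obtain ⟨_, ⟨c, hc, rfl⟩, hm⟩ := h2
    exact ⟨c, nonZeroDivisors.ne_zero hc, n, hm⟩
  choose c hc n hn using key
  refine ⟨(∏ i, c i).natAbs, by simpa [Finset.prod_eq_zero_iff] using hc, ?_⟩
  intro p hp hpD
  haveI : Fact p.Prime := ⟨hp⟩
  refine ⟨⟨hp⟩, fun x hx => ?_⟩
  funext i
  have hle : Ideal.span (Set.range Fp) ≤
      RingHom.ker (aeval (R := ℤ) x) := by
    rw [Ideal.span_le]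
    rintro _ ⟨j, rfl⟩
    exact hx j
  have h := hle (hn i)
  rw [RingHom.mem_ker] at h
  simp only [map_mul, map_pow, aeval_X, aeval_C, mul_eq_zero] at h
  rcases h with h | h
  · exfalso
    apply hpD
    rw [eq_intCast, CharP.intCast_eq_zero_iff (AlgebraicClosure (ZMod p)) p] at h
    exact Int.natCast_dvd.1 (h.trans (Finset.dvd_prod_of_mem _ (Finset.mem_univ i)))
  · exact IsReduced.pow_eq_zero h

end GoodCofinite

/-- Height growth along the orbit. -/
lemma height_growth {N d : ℕ} (hd : 2 ≤ d) (Fp : Fin (N + 1) → MvPolynomial (Fin (N + 1)) ℤ)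
    (hhom : ∀ i, (Fp i).IsHomogeneous d) (a : Fin (N + 1) → ℤ) :
    ∃ B : ℕ, 1 ≤ B ∧ ∀ n i, (((Fmap Fp)^[n] a) i).natAbs ≤ B ^ d ^ n := by
  set K : ℕ := 1 + ∑ i, ∑ m ∈ (Fp i).support, ((Fp i).coeff m).natAbs with hK
  set H : ℕ := 1 + ∑ i, (a i).natAbs with hH
  have step : ∀ (b : Fin (N + 1) → ℤ) (h : ℕ), (∀ i, (b i).natAbs ≤ h) →
      ∀ i, (Fmap Fp b i).natAbs ≤ K * h ^ d := by
    intro b h hb i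
    unfold Fmap
    rw [eval_eq']
    calc _ ≤ ∑ m ∈ (Fp i).support, (coeff m (Fp i) * ∏ j, b j ^ m j).natAbs :=
          Int.natAbs_sum_le _ _
      _ ≤ ∑ m ∈ (Fp i).support, (coeff m (Fp i)).natAbs * h ^ d := by
          apply Finset.sum_le_sum
          intro m hm
          rw [Int.natAbs_mul]
          refine Nat.mul_le_mul_left _ ?_
          have hdeg : ∑ j, m j = d := by
            have := hhom i (mem_support_iff.1 hm)
            rw [← this, Finsupp.weight_apply, Finsupp.sum_fintype _ _ (by simp)]
            simp
          have : (∏ j, b j ^ m j).natAbs = ∏ j, (b j).natAbs ^ m j := by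
            rw [← Int.natAbsHom_apply, map_prod]
            simp [Int.natAbs_pow]
          rw [this, ← hdeg, ← Finset.prod_pow_eq_pow_sum]
          exact Finset.prod_le_prod' fun j _ => Nat.pow_le_pow_left (hb j) _
      _ = (∑ m ∈ (Fp i).support, (coeff m (Fp i)).natAbs) * h ^ d := by rw [Finset.sum_mul]
      _ ≤ _ := by
          refine Nat.mul_le_mul_right _ ?_
          have := Finset.single_le_sum (f := fun i => ∑ m ∈ (Fp i).support, ((Fp i).coeff m).natAbs)
            (fun _ _ => Nat.zero_le _) (Finset.mem_univ i)
          omega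
  have hK1 : 1 ≤ K := by omega
  have main : ∀ n, ∃ h : ℕ, (∀ i, (((Fmap Fp)^[n] a) i).natAbs ≤ h) ∧ K * h ≤ (K * H) ^ d ^ n := by
    intro n
    induction n with
    | zero =>
      refine ⟨H, fun i => ?_, by simp⟩
      have := Finset.single_le_sum (f := fun i => (a i).natAbs)
            (fun _ _ => Nat.zero_le _) (Finset.mem_univ i)
      simp only [Function.iterate_zero, id_eq]
      omega
    | succ n ih =>
      obtain ⟨h, h1, h2⟩ := ih
      refine ⟨K * h ^ d, ?_, ?_⟩
      · rw [Function.iterate_succ_apply']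
        exact step _ h h1
      · calc K * (K * h ^ d) = K ^ 2 * h ^ d := by ring
          _ ≤ K ^ d * h ^ d := Nat.mul_le_mul_right _ (Nat.pow_le_pow_right hK1 hd)
          _ = (K * h) ^ d := by rw [mul_pow]
          _ ≤ ((K * H) ^ d ^ n) ^ d := Nat.pow_le_pow_left h2 _
          _ = _ := by rw [← pow_mul, pow_succ]
  refine ⟨K * H, Nat.mul_pos hK1 (by omega), fun n i => ?_⟩
  obtain ⟨h, h1, h2⟩ := main n
  exact ((h1 i).trans (Nat.le_mul_of_pos_left h hK1)).trans h2

lemma summable_of_dvd (T : Set ℕ) (M : ℕ → ℕ) (hM : ∀ j, M j ≠ 0) (r : ℝ) (hr : 0 < r)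
    (hT : ∀ p ∈ T, p.Prime ∧ ∃ j, p ∣ M j ∧ r ^ j ≤ (p : ℝ))
    (hs : Summable fun j => Real.log (M j) / r ^ j) :
    Summable (T.indicator (fun n : ℕ => Real.log n / (n : ℝ))) := by
  classical
  have hex : ∀ p, ∃ j, p ∈ T → p ∣ M j ∧ r ^ j ≤ (p : ℝ) := by
    intro p
    by_cases h : p ∈ T
    · obtain ⟨j, hj⟩ := (hT p h).2
      exact ⟨j, fun _ => hj⟩
    · exact ⟨0, fun h' => absurd h' h⟩
  choose π hπ using hex
  refine summable_of_sum_le (c := ∑' j, Real.log (M j) / r ^ j) ?_ ?_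
  · intro n
    apply Set.indicator_nonneg
    intro n _
    have := Real.log_natCast_nonneg n
    positivity
  · intro u
    rw [Finset.sum_indicator_eq_sum_filter]
    rw [← Finset.sum_fiberwise_of_maps_to (t := (u.filter (· ∈ T)).image π) (g := π)
      (fun x hx => Finset.mem_image_of_mem _ hx)]
    refine le_trans (Finset.sum_le_sum (fun j _ => ?_)) (hs.sum_le_tsum _ (fun j _ => ?_))
    · set V := (u.filter (· ∈ T)).filter (fun x => π x = j) with hV
      have hmem : ∀ p ∈ V, p.Prime ∧ p ∣ M j ∧ r ^ j ≤ (p : ℝ) := by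
        intro p hp
        simp only [hV, Finset.mem_filter] at hp
        obtain ⟨⟨_, h1⟩, h2⟩ := hp
        have := hπ p h1
        rw [h2] at this
        exact ⟨(hT p h1).1, this⟩
      calc ∑ p ∈ V, Real.log p / (p : ℝ) ≤ ∑ p ∈ V, Real.log p / r ^ j := by
            apply Finset.sum_le_sum
            intro p hp
            exact div_le_div_of_nonneg_left (Real.log_natCast_nonneg p) (by positivity) (hmem p hp).2.2
        _ = (∑ p ∈ V, Real.log p) / r ^ j := by rw [Finset.sum_div]
        _ ≤ Real.log (M j) / r ^ j := by
            apply div_le_div_of_nonneg_right _ (by positivity)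
            rw [← Real.log_prod (fun p hp => by exact_mod_cast (hmem p hp).1.ne_zero)]
            have hdvd : ∏ p ∈ V, p ∣ M j :=
              Finset.prod_primes_dvd _ (fun p hp => (hmem p hp).1.prime) (fun p hp => (hmem p hp).2.1)
            have hpos : 0 < ∏ p ∈ V, p := Finset.prod_pos fun p hp => (hmem p hp).1.pos
            rw [← Nat.cast_prod]
            exact Real.log_le_log (by exact_mod_cast hpos)
              (by exact_mod_cast Nat.le_of_dvd (Nat.pos_of_ne_zero (hM j)) hdvd)
    · have := Real.log_natCast_nonneg (M j)
      positivity

lemma pigeon {N : ℕ} (Fp : Fin (N + 1) → MvPolynomial (Fin (N + 1)) ℤ)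
    (a : Fin (N + 1) → ℤ) (p : ℕ) (hp : p.Prime) :
    ∃ m n : ℕ, m < n ∧ n ≤ orbitLen Fp a p ∧ ∀ i j : Fin (N + 1), (p : ℤ) ∣
      ((Fmap Fp)^[m] a) i * ((Fmap Fp)^[n] a) j - ((Fmap Fp)^[m] a) j * ((Fmap Fp)^[n] a) i := by
  haveI : Fact p.Prime := ⟨hp⟩
  set f : ℕ → Quotient (MulAction.orbitRel (ZMod p)ˣ (Fin (N + 1) → ZMod p)) := fun n : ℕ =>
    Quotient.mk (MulAction.orbitRel (ZMod p)ˣ (Fin (N + 1) → ZMod p))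
      (fun i => (((Fmap Fp)^[n] a) i : ZMod p)) with hf
  have hlen : orbitLen Fp a p = (Set.range f).ncard := rfl
  have : Finite (Quotient (MulAction.orbitRel (ZMod p)ˣ (Fin (N + 1) → ZMod p))) :=
    Quotient.finite _
  have hcoll : ∃ m n : ℕ, m < n ∧ n ≤ orbitLen Fp a p ∧ f m = f n := by
    by_contra! hcon
    have hinj : Set.InjOn f (Finset.range (orbitLen Fp a p + 1) : Set ℕ) := by
      intro x hx y hy hxy
      simp only [Finset.coe_range, Set.mem_Iio] at hx hy
      rcases lt_trichotomy x y with h | h | h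
      · exact absurd hxy (hcon x y h (by omega))
      · exact h
      · exact absurd hxy.symm (hcon y x h (by omega))
    have h1 := Set.ncard_image_of_injOn hinj
    rw [Set.ncard_coe_finset, Finset.card_range] at h1
    have h2 := Set.ncard_le_ncard (Set.image_subset_range f (Finset.range (orbitLen Fp a p + 1) : Set ℕ))
      (Set.toFinite _)
    omega
  obtain ⟨m, n, hmn, hn, he⟩ := hcoll
  refine ⟨m, n, hmn, hn, fun i j => ?_⟩
  have hrel := Quotient.exact he
  obtain ⟨u, hu⟩ : ∃ u : (ZMod p)ˣ, u • (fun i => (((Fmap Fp)^[n] a) i : ZMod p)) =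
    (fun i => (((Fmap Fp)^[m] a) i : ZMod p)) := hrel
  have hi := congrFun hu i
  have hj := congrFun hu j
  simp only [Pi.smul_apply, Units.smul_def, smul_eq_mul] at hi hj
  rw [← ZMod.intCast_zmod_eq_zero_iff_dvd]
  push_cast
  rw [← hi, ← hj]
  ring

lemma exists_M {N d : ℕ} (hd : 2 ≤ d)
    (Fp : Fin (N + 1) → MvPolynomial (Fin (N + 1)) ℤ)
    (hhom : ∀ i, (Fp i).IsHomogeneous d)
    (a : Fin (N + 1) → ℤ)
    (horbit : ∀ m n : ℕ, m < n → ∃ i j : Fin (N + 1),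
      ((Fmap Fp)^[m] a) i * ((Fmap Fp)^[n] a) j ≠ ((Fmap Fp)^[m] a) j * ((Fmap Fp)^[n] a) i) :
    ∃ (M : ℕ → ℕ) (A : ℕ), 1 ≤ A ∧ (∀ j, M j ≠ 0) ∧ (∀ j, M j ≤ A ^ (d ^ j * j)) ∧
      ∀ p : ℕ, p.Prime → ∃ j, j ≤ orbitLen Fp a p ∧ p ∣ M j := by
  obtain ⟨B, hB1, hB⟩ := height_growth hd Fp hhom a
  choose! s t hst using horbit
  set Q : ℕ → ℕ → ℕ := fun m n =>
    (((Fmap Fp)^[m] a) (s m n) * ((Fmap Fp)^[n] a) (t m n) -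
      ((Fmap Fp)^[m] a) (t m n) * ((Fmap Fp)^[n] a) (s m n)).natAbs with hQ
  refine ⟨fun n => ∏ m ∈ Finset.range n, Q m n, 2 * B ^ 2, ?_, ?_, ?_, ?_⟩
  · have := Nat.pow_pos (n := 2) hB1
    omega
  · intro n
    refine Finset.prod_ne_zero_iff.2 fun m hm => ?_
    have := hst m n (Finset.mem_range.1 hm)
    simp only [hQ, ne_eq, Int.natAbs_eq_zero, sub_eq_zero]
    exact this
  · intro n
    rw [pow_mul]
    refine (Finset.prod_le_pow_card _ _ ((2 * B ^ 2) ^ d ^ n) ?_).trans (by simp)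
    intro m hm
    have hmn := Finset.mem_range.1 hm
    have hb : ∀ i j, (((Fmap Fp)^[m] a) i * ((Fmap Fp)^[n] a) j).natAbs ≤ B ^ d ^ n * B ^ d ^ n := by
      intro i j
      rw [Int.natAbs_mul]
      refine Nat.mul_le_mul ((hB m i).trans ?_) (hB n j)
      exact Nat.pow_le_pow_right hB1 (Nat.pow_le_pow_right (by omega) hmn.le)
    have h2 : 2 ≤ 2 ^ d ^ n := by
      calc 2 = 2 ^ 1 := by norm_num
        _ ≤ _ := Nat.pow_le_pow_right (by norm_num) (Nat.pow_pos (by omega))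
    calc Q m n ≤ B ^ d ^ n * B ^ d ^ n + B ^ d ^ n * B ^ d ^ n :=
          (Int.natAbs_sub_le _ _).trans (Nat.add_le_add (hb _ _) (hb _ _))
      _ = 2 * (B ^ d ^ n * B ^ d ^ n) := by ring
      _ ≤ 2 ^ d ^ n * (B ^ d ^ n * B ^ d ^ n) := Nat.mul_le_mul_right _ h2
      _ = _ := by rw [← mul_pow, ← mul_pow, sq]
  · intro p hp
    obtain ⟨m, n, hmn, hn, h⟩ := pigeon Fp a p hp
    refine ⟨n, hn, ?_⟩
    refine dvd_trans ?_ (Finset.dvd_prod_of_mem (fun m => Q m n) (Finset.mem_range.2 hmn))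
    exact Int.natCast_dvd.1 (h _ _)

theorem stmt1 (N d : ℕ) (hN : 1 ≤ N) (hd : 2 ≤ d)
    (Fp : Fin (N + 1) → MvPolynomial (Fin (N + 1)) ℤ)
    (hhom : ∀ i, (Fp i).IsHomogeneous d)
    (hzero : ∀ x : Fin (N + 1) → AlgebraicClosure ℚ,
      (∀ i, MvPolynomial.aeval x (Fp i) = 0) → x = 0)
    (a : Fin (N + 1) → ℤ)
    (hcop : Finset.univ.gcd a = 1)
    (horbit : ∀ m n : ℕ, m < n → ∃ i j : Fin (N + 1),
      ((Fmap Fp)^[m] a) i * ((Fmap Fp)^[n] a) j ≠ ((Fmap Fp)^[m] a) j * ((Fmap Fp)^[n] a) i) :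
    ∃ C : ℝ, 0 < C ∧ ∀ ε : ℝ, 0 < ε →
      1 - C * ε ≤ Filter.liminf (fun s : ℝ => (s - 1) *
          ∑' p : {p : ℕ // GoodPrime Fp p ∧ ε * Real.log p ≤ (orbitLen Fp a p : ℝ)},
            Real.log p.1 / (p.1 : ℝ) ^ s)
        (𝓝[>] (1 : ℝ)) := by
  obtain ⟨D, hD0, hD⟩ := good_cofinite Fp hzero
  obtain ⟨M, A, hA1, hM0, hMA, hM⟩ := exists_M hd Fp hhom a horbit
  have hd1 : (1 : ℝ) < d := by exact_mod_cast (by omega : 1 < d)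
  have hlog : 0 < Real.log d := Real.log_pos hd1
  refine ⟨2 * Real.log d, by positivity, fun ε hε => ?_⟩
  set S : Set ℕ := {p : ℕ | GoodPrime Fp p ∧ ε * Real.log p ≤ (orbitLen Fp a p : ℝ)} with hSdef
  have hS : ∀ p ∈ S, p.Prime := fun p hp => by
    obtain ⟨⟨h, _⟩, _⟩ := hp
    exact h.out
  rcases le_or_gt 1 (2 * Real.log d * ε) with hbig | hsmall
  · exact le_trans (by linarith) (dens_nonneg S hS)
  · refine le_trans (b := (1 : ℝ)) (by
      have : 0 < 2 * Real.log d * ε := by positivity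
      linarith) (dens_one S hS ?_)
    have hT : Summable ({p : ℕ | p.Prime ∧ (orbitLen Fp a p : ℝ) < ε * Real.log p}.indicator
        (fun n : ℕ => Real.log n / (n : ℝ))) := by
      refine summable_of_dvd _ M hM0 ((d : ℝ) ^ 2) (by positivity) ?_ ?_
      · rintro p ⟨hp, hlt⟩
        refine ⟨hp, ?_⟩
        obtain ⟨j, hj, hdvd⟩ := hM p hp
        refine ⟨j, hdvd, ?_⟩
        have hp0 : (0 : ℝ) < p := by exact_mod_cast hp.pos
        rw [← Real.log_le_log_iff (by positivity) hp0, Real.log_pow, Real.log_pow]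
        have h1 : (j : ℝ) ≤ ε * Real.log p := by
          have : (j : ℝ) ≤ orbitLen Fp a p := by exact_mod_cast hj
          linarith
        have h2 : 0 ≤ Real.log (p : ℝ) := Real.log_natCast_nonneg p
        have h3 := mul_le_mul_of_nonneg_right h1 (by positivity : 0 ≤ 2 * Real.log d)
        have h4 := mul_le_mul_of_nonneg_right hsmall.le h2
        push_cast
        nlinarith
      · have hg := (summable_pow_mul_geometric_of_norm_lt_one (R := ℝ) 1 (r := (d : ℝ)⁻¹) (by
          rw [norm_inv, Real.norm_natCast]
          exact inv_lt_one_of_one_lt₀ hd1)).mul_left (Real.log A)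
        refine Summable.of_nonneg_of_le (fun j => ?_) (fun j => ?_) hg
        · have := Real.log_natCast_nonneg (M j)
          positivity
        · have h1 : Real.log (M j) ≤ (d ^ j * j : ℕ) * Real.log A := by
            rw [← Real.log_pow]
            exact Real.log_le_log (by exact_mod_cast Nat.pos_of_ne_zero (hM0 j))
              (by exact_mod_cast hMA j)
          rw [div_le_iff₀ (by positivity)]
          refine h1.trans (le_of_eq ?_)
          push_cast
          have : (d : ℝ) ≠ 0 := by positivity
          rw [inv_pow, ← pow_mul, mul_comm 2 j, pow_mul]
          field_simp
    have hDs : Summable ((D.primeFactors : Set ℕ).indicator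
        (fun n : ℕ => Real.log n / (n : ℝ))) :=
      summable_of_finite_support ((Finset.finite_toSet _).subset Set.support_indicator_subset)
    have hnn : ∀ n : ℕ, 0 ≤ Real.log n / (n : ℝ) := fun n => by
      have := Real.log_natCast_nonneg n
      positivity
    refine Summable.of_nonneg_of_le (fun n => Set.indicator_nonneg (fun n _ => hnn n) n)
      (fun n => ?_) (hT.add hDs)
    by_cases hn : n.Prime ∧ n ∉ S
    · rw [Set.indicator_of_mem (by exact hn)]
      by_cases hg : n ∣ D
      · rw [Set.indicator_of_mem (s := (D.primeFactors : Set ℕ))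
          (by simpa using ⟨hn.1, hg, hD0⟩)]
        have := Set.indicator_nonneg (s := {p : ℕ | p.Prime ∧ (orbitLen Fp a p : ℝ) < ε * Real.log p})
          (fun n _ => hnn n) n
        linarith
      · have hlt : (orbitLen Fp a n : ℝ) < ε * Real.log n := by
          by_contra hc
          exact hn.2 ⟨hD n hn.1 hg, not_lt.1 hc⟩
        rw [Set.indicator_of_mem
          (s := {p : ℕ | p.Prime ∧ (orbitLen Fp a p : ℝ) < ε * Real.log p}) (by exact ⟨hn.1, hlt⟩)]
        have := Set.indicator_nonneg (s := (D.primeFactors : Set ℕ)) (fun n _ => hnn n) n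
        linarith
    · rw [Set.indicator_of_notMem (by exact hn)]
      exact add_nonneg (Set.indicator_nonneg (fun n _ => hnn n) n)
        (Set.indicator_nonneg (fun n _ => hnn n) n)
end
end

section
/- There is a constant C > 0 (depending on K, N, F₀,…,F_N, and α) such that for every ε > 0, the set 𝒫_ε = {𝔭 a good prime ideal of 𝓞_K : m_𝔭(φ,P) ≥ ε·log N𝔭} has lower logarithmic analytic density at least 1 − C·ε; that is, liminf_{s→1⁺} (s−1)·Σ_{𝔭 ∈ 𝒫_ε} (log N𝔭)/(N𝔭)^s ≥ 1 − C·ε. -/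
open MvPolynomial NumberField Filter Topology

noncomputable section


/-- The map on integral vectors induced by the homogeneous polynomials `Fp i`. -/
def FmapK (K : Type) [Field K] [NumberField K] {N : ℕ}
    (Fp : Fin (N + 1) → MvPolynomial (Fin (N + 1)) (𝓞 K)) :
    (Fin (N + 1) → 𝓞 K) → (Fin (N + 1) → 𝓞 K) :=
  fun b i => MvPolynomial.eval b (Fp i)

/-- A nonzero prime ideal `p` of `𝓞 K` is good (for `Fp` and `α`) if `p` does not contain the
ideal generated by the coordinates of `α`, and the reductions of the `Fp i` modulo `p` have no
common zero in an algebraic closure of the residue field `𝓞 K ⧸ p` other than the origin. -/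
def GoodIdeal (K : Type) [Field K] [NumberField K] {N : ℕ}
    (Fp : Fin (N + 1) → MvPolynomial (Fin (N + 1)) (𝓞 K))
    (α : Fin (N + 1) → 𝓞 K) (p : Ideal (𝓞 K)) : Prop :=
  p.IsPrime ∧ p ≠ ⊥ ∧ ¬ (Ideal.span (Set.range α) ≤ p) ∧
  ∃ hm : p.IsMaximal,
    letI : Field ((𝓞 K) ⧸ p) := @Ideal.Quotient.field _ _ p hm
    ∀ x : Fin (N + 1) → AlgebraicClosure ((𝓞 K) ⧸ p),
      (∀ i, MvPolynomial.aeval x ((Fp i).map (Ideal.Quotient.mk p)) = 0) → x = 0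

/-- The number of distinct points of `ℙ^N(𝔽_p)` represented by the reductions mod `p` of the
iterates `F^[n](α)`, i.e. the size of the orbit of `P mod p`. -/
def orbitLenK (K : Type) [Field K] [NumberField K] {N : ℕ}
    (Fp : Fin (N + 1) → MvPolynomial (Fin (N + 1)) (𝓞 K))
    (α : Fin (N + 1) → 𝓞 K) (p : Ideal (𝓞 K)) : ℕ :=
  Set.ncard (Set.range fun n : ℕ =>
    Quotient.mk (MulAction.orbitRel ((𝓞 K) ⧸ p)ˣ (Fin (N + 1) → (𝓞 K) ⧸ p))
      (fun i => Ideal.Quotient.mk p (((FmapK K Fp)^[n] α) i)))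

section zeta
variable (K : Type) [Field K] [NumberField K]

lemma aux_fiber (s : ℝ) (hs : 1 < s) (n : ℕ) :
    ∑' I : {I : Ideal (𝓞 K) // Ideal.absNorm I = n}, (Ideal.absNorm I.1 : ℝ) ^ (-s) =
      ‖LSeries.term (fun n ↦ (Nat.card {I : Ideal (𝓞 K) // Ideal.absNorm I = n} : ℂ)) s n‖ := by
  have h : ∀ I : {I : Ideal (𝓞 K) // Ideal.absNorm I = n}, 
    (Ideal.absNorm I.1 : ℝ) ^ (-s) = (n:ℝ)^(-s) := fun I => by rw [I.2]
  simp_rw [h, tsum_const, LSeries.norm_term_eq]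
  split_ifs with h0
  · subst h0
    simp [Real.zero_rpow (by linarith : -s ≠ 0)]
  · simp [Real.rpow_neg, div_eq_mul_inv]

lemma term_eq_norm (s : ℝ) (n : ℕ) :
    LSeries.term (fun n ↦ (Nat.card {I : Ideal (𝓞 K) // Ideal.absNorm I = n} : ℂ)) s n =
     (‖LSeries.term (fun n ↦ (Nat.card {I : Ideal (𝓞 K) // Ideal.absNorm I = n} : ℂ)) s n‖ : ℝ) := by
  rw [LSeries.norm_term_eq, LSeries.term_def]
  split_ifs with h0
  · simp
  · simp [Complex.ofReal_cpow]

lemma lsum (s : ℝ) (hs : 1 < s) : 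
    LSeriesSummable (fun n ↦ (Nat.card {I : Ideal (𝓞 K) // Ideal.absNorm I = n} : ℂ)) s := by
  have h := (tendsto_sub_one_mul_dedekindZeta_nhdsGT K)
  have h2 := h.eventually_ne (Complex.ofReal_ne_zero.2 (dedekindZeta_residue_ne_zero K))
  have h3 : ∀ᶠ t : ℝ in 𝓝[>] 1, t < s := 
    (tendsto_nhdsWithin_of_tendsto_nhds tendsto_id).eventually (gt_mem_nhds hs)
  obtain ⟨t, ht, hts⟩ := (h2.and h3).exists
  have : LSeriesSummable (fun n ↦ (Nat.card {I : Ideal (𝓞 K) // Ideal.absNorm I = n} : ℂ)) t := by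
    by_contra hcon
    apply ht
    rw [dedekindZeta, LSeries, tsum_eq_zero_of_not_summable hcon, mul_zero]
  exact this.of_re_le_re (by simpa using hts.le)

lemma zsum (s : ℝ) (hs : 1 < s) :
    Summable (fun I : Ideal (𝓞 K) => (Ideal.absNorm I : ℝ) ^ (-s)) := by
  rw [← (Equiv.sigmaFiberEquiv (fun I : Ideal (𝓞 K) => Ideal.absNorm I)).summable_iff]
  rw [summable_sigma_of_nonneg]
  · constructor
    · intro n
      have : Finite {I : Ideal (𝓞 K) // Ideal.absNorm I = n} := Ideal.finite_setOfPred_absNorm_eq n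
      exact Summable.of_finite
    · have := (lsum K s hs).norm
      refine this.congr fun n => ?_
      rw [← aux_fiber K s hs n]
      rfl
  · intro x
    exact Real.rpow_nonneg (by positivity) _

lemma zeta_eq (s : ℝ) (hs : 1 < s) :
    dedekindZeta K s = ((∑' I : Ideal (𝓞 K), (Ideal.absNorm I : ℝ) ^ (-s) : ℝ) : ℂ) := by
  have h := zsum K s hs
  rw [← (Equiv.sigmaFiberEquiv (fun I : Ideal (𝓞 K) => Ideal.absNorm I)).tsum_eq]
  rw [← (Equiv.sigmaFiberEquiv (fun I : Ideal (𝓞 K) => Ideal.absNorm I)).summable_iff] at h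
  rw [dedekindZeta, LSeries, tsum_congr (term_eq_norm K s), ← Complex.ofReal_tsum]
  congr 1
  refine Eq.trans ?_ (h.tsum_sigma).symm
  refine tsum_congr fun n => ?_
  rw [← aux_fiber K s hs n]
  rfl

def Zt (s : ℝ) : ℝ := ∑' I : Ideal (𝓞 K), (Ideal.absNorm I : ℝ) ^ (-s)

lemma Zt_tendsto : Tendsto (fun s : ℝ => (s - 1) * Zt K s) (𝓝[>] 1) (𝓝 (dedekindZeta_residue K)) := by
  have h := (tendsto_sub_one_mul_dedekindZeta_nhdsGT K)
  have h2 : Tendsto (fun s : ℝ => (((s - 1) * Zt K s : ℝ) : ℂ)) (𝓝[>] 1) (𝓝 (dedekindZeta_residue K : ℂ)) := by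
    refine h.congr' ?_
    filter_upwards [self_mem_nhdsWithin] with s hs
    rw [zeta_eq K s hs, Zt]
    push_cast
    rfl
  exact (Complex.continuous_re.tendsto _).comp h2

lemma Zt_pos (s : ℝ) (hs : 1 < s) : 0 < Zt K s := by
  refine (zsum K s hs).tsum_pos (fun I => by positivity) ⊤ ?_
  simp

end zeta

section primes
variable (K : Type) [Field K] [NumberField K]

def Pset : Set (Ideal (𝓞 K)) := {p | p.IsPrime ∧ p ≠ ⊥}

variable {K}

lemma Pset.prime {p : Ideal (𝓞 K)} (hp : p ∈ Pset K) : Prime p :=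
  Ideal.prime_of_isPrime hp.2 hp.1

lemma Pset.two_le {p : Ideal (𝓞 K)} (hp : p ∈ Pset K) : 2 ≤ Ideal.absNorm p := by
  have h0 : Ideal.absNorm p ≠ 0 := by
    rw [Ne, Ideal.absNorm_eq_zero_iff]; exact hp.2
  have h1 : Ideal.absNorm p ≠ 1 := by
    rw [Ne, Ideal.absNorm_eq_one_iff]; exact hp.1.ne_top
  omega

open Classical UniqueFactorizationMonoid in
lemma inner_tsum {I : Ideal (𝓞 K)} (hI : I ≠ ⊥) {p : Ideal (𝓞 K)} (hp : p ∈ Pset K) (c : ENNReal) :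
    ∑' k : ℕ, (if p ^ (k + 1) ∣ I then c else 0) = (normalizedFactors I).count p * c := by
  have h : ∀ k : ℕ, p ^ (k+1) ∣ I ↔ k ∈ Finset.range ((normalizedFactors I).count p) := by
    intro k
    rw [pow_dvd_iff_le_emultiplicity, emultiplicity_eq_count_normalizedFactors 
      (Pset.prime hp).irreducible (by simpa using hI), normalize_eq, Finset.mem_range,
      Nat.cast_le, Nat.succ_le_iff]
  simp_rw [h]
  rw [tsum_eq_sum (s := Finset.range ((normalizedFactors I).count p))]
  · rw [Finset.sum_ite_mem]; simp
  · intro k hk; simp [hk]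

open Classical UniqueFactorizationMonoid in
lemma log_norm_eq {I : Ideal (𝓞 K)} (hI : I ≠ ⊥) :
    Real.log (Ideal.absNorm I) = ∑ p ∈ (normalizedFactors I).toFinset, 
      (normalizedFactors I).count p * Real.log (Ideal.absNorm p) := by
  have h := Ideal.prod_normalizedFactors_eq_self hI
  have h2 : (Ideal.absNorm I : ℝ) = ∏ p ∈ (normalizedFactors I).toFinset, 
      (Ideal.absNorm p : ℝ) ^ ((normalizedFactors I).count p) := by
    conv_lhs => rw [← h]
    rw [Finset.prod_multiset_count, map_prod]
    push_cast [map_pow]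
    rfl
  rw [h2, Real.log_prod]
  · simp
  · intro p hp
    rw [Multiset.mem_toFinset, Ideal.mem_normalizedFactors_iff hI] at hp
    have := hp.1.ne_top
    apply pow_ne_zero
    rw [Nat.cast_ne_zero, Ne, Ideal.absNorm_eq_zero_iff]
    rintro rfl
    exact hI (by simpa using hp.2)

open Classical UniqueFactorizationMonoid in
lemma log_norm_tsum {I : Ideal (𝓞 K)} (hI : I ≠ ⊥) :
    ENNReal.ofReal (Real.log (Ideal.absNorm I)) = ∑' p : Pset K, ∑' k : ℕ, 
      (if p.1 ^ (k + 1) ∣ I then ENNReal.ofReal (Real.log (Ideal.absNorm p.1)) else 0) := by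
  have h1 : ∀ p : Pset K, ∑' k : ℕ, 
      (if p.1 ^ (k + 1) ∣ I then ENNReal.ofReal (Real.log (Ideal.absNorm p.1)) else 0) = 
      (fun p : Ideal (𝓞 K) => ((normalizedFactors I).count p : ENNReal) * 
        ENNReal.ofReal (Real.log (Ideal.absNorm p))) p.1 := fun p => inner_tsum hI p.2 _
  rw [tsum_congr h1, tsum_subtype (Pset K) (fun p : Ideal (𝓞 K) => ((normalizedFactors I).count p : ENNReal) * 
        ENNReal.ofReal (Real.log (Ideal.absNorm p))), tsum_eq_sum (s := (normalizedFactors I).toFinset), 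
    log_norm_eq hI, ENNReal.ofReal_sum_of_nonneg]
  · refine Finset.sum_congr rfl fun p hp => ?_
    rw [Multiset.mem_toFinset, Ideal.mem_normalizedFactors_iff hI] at hp
    rw [Set.indicator_of_mem, ENNReal.ofReal_mul (by positivity), ENNReal.ofReal_natCast]
    refine ⟨hp.1, ?_⟩
    rintro rfl
    exact hI (by simpa using hp.2)
  · intro p _
    have := Real.log_natCast_nonneg (Ideal.absNorm p)
    positivity
  · intro p hp
    rw [Multiset.mem_toFinset] at hp
    simp [Set.indicator, Multiset.count_eq_zero_of_notMem hp]

variable (K)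

/-- summand -/
def gE (s : ℝ) (I : Ideal (𝓞 K)) : ENNReal := ENNReal.ofReal ((Ideal.absNorm I : ℝ) ^ (-s))

lemma gE_mul (s : ℝ) (I J : Ideal (𝓞 K)) : gE K s (I * J) = gE K s I * gE K s J := by
  rw [gE, gE, gE, ← ENNReal.ofReal_mul (by positivity), map_mul, Nat.cast_mul, 
    Real.mul_rpow (by positivity) (by positivity)]

open Classical in
lemma sum_dvd (s : ℝ) (q : Ideal (𝓞 K)) (hq : q ≠ ⊥) (c : ENNReal) : 
    ∑' I, (if q ∣ I then c else 0) * gE K s I = c * gE K s q * ∑' I, gE K s I := by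
  have hinj : Function.Injective (fun J : Ideal (𝓞 K) => q * J) := mul_right_injective₀ (by simpa using hq)
  rw [← hinj.tsum_eq (f := fun I => (if q ∣ I then c else 0) * gE K s I), ← ENNReal.tsum_mul_left]
  · refine tsum_congr fun J => ?_
    simp [gE_mul, mul_assoc]
  · intro I hI
    by_cases h : q ∣ I
    · obtain ⟨J, rfl⟩ := h
      exact ⟨J, rfl⟩
    · simp [h] at hI

lemma D_eq (s : ℝ) (hs : 1 < s) : 
    ∑' I : Ideal (𝓞 K), ENNReal.ofReal (Real.log (Ideal.absNorm I)) * gE K s I = 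
    (∑' p : Pset K, ∑' k : ℕ, ENNReal.ofReal (Real.log (Ideal.absNorm p.1)) * gE K s (p.1 ^ (k+1))) * 
      ∑' I, gE K s I := by
  classical
  rw [← ENNReal.tsum_mul_right]
  simp_rw [← ENNReal.tsum_mul_right]
  have : ∀ I : Ideal (𝓞 K), ENNReal.ofReal (Real.log (Ideal.absNorm I)) * gE K s I = 
     ∑' p : Pset K, ∑' k : ℕ, 
      (if p.1 ^ (k + 1) ∣ I then ENNReal.ofReal (Real.log (Ideal.absNorm p.1)) else 0) * gE K s I := by
    intro I
    by_cases hI : I = ⊥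
    · subst hI
      simp [gE, Real.zero_rpow (by linarith : -s ≠ 0)]
    · rw [log_norm_tsum hI, ← ENNReal.tsum_mul_right]
      simp_rw [← ENNReal.tsum_mul_right]
  rw [tsum_congr this, ENNReal.tsum_comm]
  refine tsum_congr fun p => ?_
  rw [ENNReal.tsum_comm]
  refine tsum_congr fun k => ?_
  exact sum_dvd K s _ (by simpa using pow_ne_zero (k+1) (Pset.prime p.2).ne_zero) _

end primes

section real
variable (K : Type) [Field K] [NumberField K]

def DE (s : ℝ) : ENNReal := ∑' I : Ideal (𝓞 K), ENNReal.ofReal (Real.log (Ideal.absNorm I)) * gE K s I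
def TE (s : ℝ) : ENNReal := ∑' p : Pset K, ENNReal.ofReal (Real.log (Ideal.absNorm p.1)) * gE K s p.1
def ZE (s : ℝ) : ENNReal := ∑' I : Ideal (𝓞 K), gE K s I

lemma ZE_eq (s : ℝ) (hs : 1 < s) : ZE K s = ENNReal.ofReal (Zt K s) := by
  rw [ZE, Zt, ENNReal.ofReal_tsum_of_nonneg (fun I => by positivity) (zsum K s hs)]
  rfl

lemma TE_mul_le (s : ℝ) (hs : 1 < s) : TE K s * ZE K s ≤ DE K s := by
  rw [DE, D_eq K s hs, TE, ZE]
  gcongr with p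
  have := ENNReal.le_tsum (f := fun k : ℕ => ENNReal.ofReal (Real.log (Ideal.absNorm p.1)) * gE K s (p.1 ^ (k+1))) 0
  simpa using this

lemma gE_pow (s : ℝ) (p : Ideal (𝓞 K)) (k : ℕ) : gE K s (p ^ (k+1)) = gE K s p * gE K s p ^ k := by
  induction k with
  | zero => simp
  | succ k ih => rw [pow_succ, gE_mul, ih, pow_succ, mul_assoc]

lemma gE_anti {s t : ℝ} (hst : s ≤ t) {p : Ideal (𝓞 K)} (hp : p ∈ Pset K) : gE K t p ≤ gE K s p := by
  apply ENNReal.ofReal_le_ofReal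
  have : (2:ℝ) ≤ Ideal.absNorm p := by exact_mod_cast Pset.two_le hp
  exact Real.rpow_le_rpow_of_exponent_le (by linarith) (by linarith)

lemma gE_one_le {p : Ideal (𝓞 K)} (hp : p ∈ Pset K) : gE K 1 p ≤ 2⁻¹ := by
  have : (2:ℝ) ≤ Ideal.absNorm p := by exact_mod_cast Pset.two_le hp
  rw [gE, Real.rpow_neg_one]
  have h2 : (2⁻¹ : ENNReal) = ENNReal.ofReal (2⁻¹) := by
    rw [ENNReal.ofReal_inv_of_pos (by norm_num)]; simp
  rw [h2]
  apply ENNReal.ofReal_le_ofReal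
  gcongr

lemma gE_two (p : Ideal (𝓞 K)) : gE K 1 p * gE K 1 p = gE K 2 p := by
  rw [gE, gE, ← ENNReal.ofReal_mul (by positivity), Real.rpow_neg_one, Real.rpow_neg (by positivity)]
  norm_num [sq]

lemma DE_le (s : ℝ) (hs : 1 < s) : DE K s ≤ (TE K s + 2 * TE K 2) * ZE K s := by
  rw [DE, D_eq K s hs, TE, TE, ZE, ← ENNReal.tsum_mul_left (a := 2), ← ENNReal.tsum_add]
  gcongr with p
  set l := ENNReal.ofReal (Real.log (Ideal.absNorm p.1))
  simp_rw [gE_pow]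
  set x := gE K s p.1 with hx
  have h1 : x ≤ gE K 1 p.1 := gE_anti K hs.le p.2
  have h2 : x ≤ 2⁻¹ := h1.trans (gE_one_le K p.2)
  have h3 : ∑' k : ℕ, x ^ k ≤ 2 := by
    calc ∑' k : ℕ, x ^ k ≤ ∑' k : ℕ, (2⁻¹ : ENNReal) ^ k := by gcongr
      _ = 2 := by rw [ENNReal.tsum_geometric]; simp
  have h4 : ∑' k : ℕ, x ^ k ≤ 1 + x * 2 := by
    rw [tsum_eq_zero_add' ENNReal.summable]
    simp_rw [pow_succ']
    rw [ENNReal.tsum_mul_left, pow_zero]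
    gcongr
  rw [ENNReal.tsum_mul_left, ENNReal.tsum_mul_left]
  calc l * (x * ∑' k : ℕ, x ^ k) ≤ l * (x * (1 + x * 2)) := by gcongr
    _ = l * x + 2 * (l * (x * x)) := by ring
    _ ≤ l * x + 2 * (l * (gE K 1 p.1 * gE K 1 p.1)) := by gcongr
    _ = _ := by rw [gE_two]

lemma log_le_pow {n : ℕ} {s t : ℝ} (ht : 1 < t) (hts : t < s) :
    Real.log n * (n:ℝ) ^ (-s) ≤ (n:ℝ) ^ (-t) / (s - t) := by
  rcases Nat.eq_zero_or_pos n with rfl | hn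
  · simp [Real.zero_rpow (by linarith : -t ≠ 0)]
  · have hn' : (0:ℝ) < n := by exact_mod_cast hn
    have := Real.log_le_rpow_div hn'.le (sub_pos.2 hts)
    calc Real.log n * (n:ℝ) ^ (-s) ≤ (n ^ (s - t) / (s - t)) * (n:ℝ) ^ (-s) := by gcongr
      _ = (n ^ (s - t) * (n:ℝ) ^ (-s)) / (s - t) := by ring
      _ = _ := by rw [← Real.rpow_add hn']; ring_nf

lemma Dsummable {s : ℝ} (hs : 1 < s) : 
    Summable (fun I : Ideal (𝓞 K) => Real.log (Ideal.absNorm I) * (Ideal.absNorm I : ℝ) ^ (-s)) := by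
  obtain ⟨t, ht, hts⟩ := exists_between hs
  refine Summable.of_nonneg_of_le (fun I => ?_) (fun I => log_le_pow ht hts) ((zsum K t ht).div_const _)
  have := Real.log_natCast_nonneg (Ideal.absNorm I)
  positivity

def Dt (s : ℝ) : ℝ := ∑' I : Ideal (𝓞 K), Real.log (Ideal.absNorm I) * (Ideal.absNorm I : ℝ) ^ (-s)

lemma DE_eq {s : ℝ} (hs : 1 < s) : DE K s = ENNReal.ofReal (Dt K s) := by
  have h : ∀ n : ℕ, 0 ≤ Real.log n := Real.log_natCast_nonneg
  rw [DE, Dt, ENNReal.ofReal_tsum_of_nonneg (fun I => mul_nonneg (h _) (by positivity)) (Dsummable K hs)]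
  refine tsum_congr fun I => ?_
  rw [ENNReal.ofReal_mul (h _), gE]

lemma Dt_nonneg (s : ℝ) : 0 ≤ Dt K s := tsum_nonneg fun I => 
  mul_nonneg (Real.log_natCast_nonneg _) (by positivity)

lemma Dt_le {s t : ℝ} (ht : 1 < t) (hts : t < s) : Dt K s ≤ Zt K t / (s - t) := by
  rw [Dt, Zt, ← tsum_div_const]
  exact (Dsummable K (ht.trans hts)).tsum_le_tsum (fun I => log_le_pow ht hts) ((zsum K t ht).div_const _)

lemma le_Dt {s t : ℝ} (hs : 1 < s) (hst : s < t) : Zt K s - Zt K t ≤ (t - s) * Dt K s := by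
  rw [Dt, Zt, Zt, ← tsum_mul_left, ← (zsum K s hs).tsum_sub (zsum K t (hs.trans hst))]
  refine ((zsum K s hs).sub (zsum K t (hs.trans hst))).tsum_le_tsum (fun I => ?_) ((Dsummable K hs).mul_left _)
  rcases Nat.eq_zero_or_pos (Ideal.absNorm I) with h | hn
  · rw [h]; simp [Real.zero_rpow (by linarith : -t ≠ 0), Real.zero_rpow (by linarith : -s ≠ 0)]
  · have hn' : (0:ℝ) < Ideal.absNorm I := by exact_mod_cast hn
    set n : ℝ := ((Ideal.absNorm I : ℕ) : ℝ)
    have h1 : n ^ (-t) = n ^ (-s) * n ^ (-(t-s)) := by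
      rw [← Real.rpow_add hn']; ring_nf
    have h2 : 1 - (t - s) * Real.log n ≤ n ^ (-(t-s)) := by
      rw [Real.rpow_def_of_pos hn']
      have := Real.add_one_le_exp (Real.log n * (-(t-s)))
      linarith
    have h3 : 0 ≤ n ^ (-s) := by positivity
    rw [h1]
    nlinarith

def wt (s : ℝ) (p : Ideal (𝓞 K)) : ℝ := Real.log (Ideal.absNorm p) / (Ideal.absNorm p : ℝ) ^ s

lemma wt_eq (s : ℝ) (p : Ideal (𝓞 K)) : 
    wt K s p = Real.log (Ideal.absNorm p) * (Ideal.absNorm p : ℝ) ^ (-s) := by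
  rw [wt, Real.rpow_neg (by positivity), div_eq_mul_inv]

lemma wt_nonneg (s : ℝ) (p : Ideal (𝓞 K)) : 0 ≤ wt K s p := by
  rw [wt_eq]; exact mul_nonneg (Real.log_natCast_nonneg _) (by positivity)

lemma wt_summable {s : ℝ} (hs : 1 < s) : Summable (wt K s) := by
  refine (Dsummable K hs).congr fun p => (wt_eq K s p).symm

def Tt (s : ℝ) : ℝ := ∑' p : Pset K, wt K s p.1

lemma Tt_nonneg (s : ℝ) : 0 ≤ Tt K s := tsum_nonneg fun p => wt_nonneg K s p.1

lemma TE_eq {s : ℝ} (hs : 1 < s) : TE K s = ENNReal.ofReal (Tt K s) := by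
  have h1 : Summable (fun p : Pset K => wt K s p.1) := (wt_summable K hs).subtype _
  have h2 : ∀ p : Pset K, 0 ≤ wt K s p.1 := fun p => wt_nonneg K s p.1
  rw [TE, Tt, ENNReal.ofReal_tsum_of_nonneg h2 h1]
  refine tsum_congr fun I => ?_
  rw [wt_eq, ENNReal.ofReal_mul (Real.log_natCast_nonneg _), gE]

lemma Tt_mul_le {s : ℝ} (hs : 1 < s) : Tt K s * Zt K s ≤ Dt K s := by
  have h := TE_mul_le K s hs
  rw [TE_eq K hs, ZE_eq K s hs, DE_eq K hs, ← ENNReal.ofReal_mul (Tt_nonneg K s)] at h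
  exact (ENNReal.ofReal_le_ofReal_iff (Dt_nonneg K s)).1 h

lemma Dt_le_mul {s : ℝ} (hs : 1 < s) : Dt K s ≤ (Tt K s + 2 * Tt K 2) * Zt K s := by
  have h := DE_le K s hs
  have h1 := Tt_nonneg K s
  have h2 := Tt_nonneg K 2
  have h3 := Zt_pos K s hs
  have h4 : (2 : ENNReal) = ENNReal.ofReal 2 := by simp
  rw [TE_eq K hs, TE_eq K one_lt_two, ZE_eq K s hs, DE_eq K hs, h4, ← ENNReal.ofReal_mul (by norm_num), 
    ← ENNReal.ofReal_add (by positivity) (by positivity), ← ENNReal.ofReal_mul (by positivity)] at h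
  exact (ENNReal.ofReal_le_ofReal_iff (by positivity)).1 h

/-- boundedness -/
lemma Tt_bdd : ∃ M : ℝ, 0 < M ∧ ∃ s₀ : ℝ, 1 < s₀ ∧ ∀ s, 1 < s → s < s₀ → (s - 1) * Tt K s ≤ M := by
  set ρ := dedekindZeta_residue K with hρ
  have hpos : 0 < ρ := dedekindZeta_residue_pos K
  have h1 : ∀ᶠ s : ℝ in 𝓝[>] 1, ρ / 2 < (s - 1) * Zt K s ∧ (s - 1) * Zt K s < 2 * ρ := 
    ((Zt_tendsto K).eventually (lt_mem_nhds (by linarith))).and 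
    ((Zt_tendsto K).eventually (gt_mem_nhds (by linarith)))
  rw [eventually_nhdsWithin_iff, Metric.eventually_nhds_iff] at h1
  obtain ⟨δ, hδ, h1⟩ := h1
  refine ⟨16, by norm_num, 1 + δ, by linarith, fun s hs hs' => ?_⟩
  have hA := (h1 (y := s) (by rw [Real.dist_eq, abs_lt]; constructor <;> linarith) hs).1
  have hB := (h1 (y := (1 + s)/2) (by rw [Real.dist_eq, abs_lt]; constructor <;> linarith) 
    (by simp only [Set.mem_Ioi]; linarith)).2
  have hC := Dt_le K (s := s) (t := (1+s)/2) (by linarith) (by linarith)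
  have hD := Tt_mul_le K hs
  have hE := Tt_nonneg K s
  have hZ := Zt_pos K s hs
  set Z2 := Zt K ((1 + s)/2)
  rw [le_div_iff₀ (by linarith)] at hC
  set u := s - 1 with hu
  have hu0 : 0 < u := by linarith
  have e1 : (1 + s)/2 - 1 = u / 2 := by rw [hu]; ring
  have e2 : s - (1 + s)/2 = u / 2 := by rw [hu]; ring
  rw [e1] at hB
  rw [e2] at hC
  -- u T * (u Z) ≤ u^2 D ≤ 2 u Z2 ≤ 8 ρ
  have h5 : (u * Tt K s) * (u * Zt K s) ≤ 8 * ρ := by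
    calc (u * Tt K s) * (u * Zt K s) = u ^ 2 * (Tt K s * Zt K s) := by ring
      _ ≤ u ^ 2 * Dt K s := by gcongr
      _ = 2 * u * (Dt K s * (u / 2)) := by ring
      _ ≤ 2 * u * Z2 := by gcongr
      _ ≤ 8 * ρ := by linarith
  have h6 : (u * Tt K s) * (ρ / 2) ≤ 8 * ρ := le_trans (by gcongr) h5
  nlinarith

lemma Tt_lower (η : ℝ) (hη : 0 < η) : ∀ᶠ s : ℝ in 𝓝[>] 1, 1 - η ≤ (s - 1) * Tt K s := by
  set ρ := dedekindZeta_residue K with hρ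
  have hpos : 0 < ρ := dedekindZeta_residue_pos K
  -- limit with t = s + δ (s-1)
  have key : ∀ δ > 0, Tendsto (fun s : ℝ => ((s - 1) * Zt K s - (s - 1) * Zt K (s + δ * (s - 1))) / 
      (δ * ((s - 1) * Zt K s)) - (s - 1) * (2 * Tt K 2)) 
      (𝓝[>] 1) (𝓝 ((ρ - ρ / (1 + δ)) / (δ * ρ) - 0)) := by
    intro δ hδ
    have hm : Tendsto (fun s : ℝ => s + δ * (s - 1)) (𝓝[>] 1) (𝓝[>] 1) := by
      apply tendsto_nhdsWithin_of_tendsto_nhds_of_eventually_within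
      · refine tendsto_nhdsWithin_of_tendsto_nhds ?_
        have : Continuous (fun s : ℝ => s + δ * (s - 1)) := by fun_prop
        simpa using this.tendsto 1
      · filter_upwards [self_mem_nhdsWithin] with s hs
        simp only [Set.mem_Ioi] at hs ⊢
        nlinarith
    have h2 := ((Zt_tendsto K).comp hm).div_const (1 + δ)
    have h3 : Tendsto (fun s : ℝ => (s - 1) * Zt K (s + δ * (s - 1))) (𝓝[>] 1) (𝓝 (ρ / (1 + δ))) := by
      refine h2.congr fun s => ?_
      simp only [Function.comp]
      field_simp
      ring
    have h0 : Tendsto (fun s : ℝ => (s - 1) * (2 * Tt K 2)) (𝓝[>] 1) (𝓝 0) := by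
      refine tendsto_nhdsWithin_of_tendsto_nhds ?_
      have : Continuous (fun s : ℝ => (s - 1) * (2 * Tt K 2)) := by fun_prop
      simpa using this.tendsto 1
    exact (((Zt_tendsto K).sub h3).div ((Zt_tendsto K).const_mul δ) (by positivity)).sub h0
  have h1 := key η hη
  have e : (ρ - ρ / (1 + η)) / (η * ρ) - 0 = 1 / (1 + η) := by
    field_simp; ring
  rw [e] at h1
  have hlt : 1 - η < 1 / (1 + η) := by
    rw [lt_div_iff₀ (by linarith)]; nlinarith
  filter_upwards [h1.eventually (lt_mem_nhds hlt), self_mem_nhdsWithin] with s hs hs1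
  simp only [Set.mem_Ioi] at hs1
  refine hs.le.trans ?_
  have hZ := Zt_pos K s hs1
  have hu : 0 < s - 1 := by linarith
  have h4 := le_Dt K hs1 (t := s + η * (s - 1)) (by nlinarith)
  have h5 := Dt_le_mul K hs1
  rw [sub_le_iff_le_add, div_le_iff₀ (by positivity)]
  calc (s - 1) * Zt K s - (s - 1) * Zt K (s + η * (s - 1)) 
     = (s - 1) * (Zt K s - Zt K (s + η * (s - 1))) := by ring
    _ ≤ (s - 1) * ((s + η * (s - 1) - s) * Dt K s) := by gcongr
    _ ≤ (s - 1) * ((s + η * (s - 1) - s) * ((Tt K s + 2 * Tt K 2) * Zt K s)) := by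
      have : 0 ≤ s + η * (s - 1) - s := by nlinarith
      gcongr
    _ = _ := by ring

end real

section bad
variable (K : Type) [Field K] [NumberField K] {N : ℕ}

lemma clear_denoms {ι : Type} [Finite ι] (g : ι → MvPolynomial (Fin (N+1)) K) :
    ∃ c : 𝓞 K, c ≠ 0 ∧ ∃ h : ι → MvPolynomial (Fin (N+1)) (𝓞 K), 
      ∀ i, (h i).map (algebraMap (𝓞 K) K) = MvPolynomial.C (algebraMap (𝓞 K) K c) * g i := by
  letI := MvPolynomial.algebraMvPolynomial (R := 𝓞 K) (S := K) (σ := Fin (N+1))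
  obtain ⟨b, hb⟩ := IsLocalization.exist_integer_multiples_of_finite 
    ((nonZeroDivisors (𝓞 K)).map (MvPolynomial.C (σ := Fin (N+1)))) g
  obtain ⟨b, c, hc, rfl⟩ := b
  refine ⟨c, nonZeroDivisors.ne_zero hc, ?_⟩
  choose h hh using hb
  refine ⟨h, fun i => ?_⟩
  have := hh i
  simp only [Algebra.smul_def, MvPolynomial.algebraMap_def, MvPolynomial.map_C] at this
  exact this

lemma null_one (Fp : Fin (N + 1) → MvPolynomial (Fin (N + 1)) (𝓞 K))
    (hzero : ∀ x : Fin (N + 1) → AlgebraicClosure K,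
      (∀ i, MvPolynomial.aeval x ((Fp i).map (algebraMap (𝓞 K) K)) = 0) → x = 0) (j : Fin (N+1)) :
    ∃ c : 𝓞 K, c ≠ 0 ∧ ∃ k : ℕ, ∃ h : Fin (N+1) → MvPolynomial (Fin (N+1)) (𝓞 K), 
      ∑ i, h i * Fp i = MvPolynomial.C c * MvPolynomial.X j ^ k := by
  have h1 : (MvPolynomial.X j : MvPolynomial (Fin (N+1)) K) ∈ 
      (Ideal.span (Set.range fun i => (Fp i).map (algebraMap (𝓞 K) K))).radical := by
    rw [← MvPolynomial.vanishingIdeal_zeroLocus_eq_radical (K := AlgebraicClosure K)]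
    intro x hx
    rw [MvPolynomial.zeroLocus_span] at hx
    have : x = 0 := hzero x fun i => hx _ ⟨i, rfl⟩
    simp [this]
  obtain ⟨k, hk⟩ := h1
  rw [Ideal.mem_span_range_iff_exists_fun] at hk
  obtain ⟨g, hg⟩ := hk
  obtain ⟨c, hc, h, hh⟩ := clear_denoms K g
  refine ⟨c, hc, k, h, ?_⟩
  apply MvPolynomial.map_injective (algebraMap (𝓞 K) K) (FaithfulSMul.algebraMap_injective (𝓞 K) K)
  simp only [map_sum, map_mul, hh, MvPolynomial.map_C, map_pow, MvPolynomial.map_X, ← hg, Finset.mul_sum, mul_assoc]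

lemma good_of_notMem (Fp : Fin (N + 1) → MvPolynomial (Fin (N + 1)) (𝓞 K))
    (hzero : ∀ x : Fin (N + 1) → AlgebraicClosure K,
      (∀ i, MvPolynomial.aeval x ((Fp i).map (algebraMap (𝓞 K) K)) = 0) → x = 0) 
    (α : Fin (N + 1) → 𝓞 K) (hα : α ≠ 0) :
    ∃ c : 𝓞 K, c ≠ 0 ∧ ∀ p ∈ Pset K, c ∉ p → GoodIdeal K Fp α p := by
  choose c hc k h hh using null_one K Fp hzero
  obtain ⟨i₀, hi₀⟩ := Function.ne_iff.1 hα
  refine ⟨α i₀ * ∏ j, c j, mul_ne_zero hi₀ (Finset.prod_ne_zero_iff.2 fun j _ => hc j), ?_⟩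
  intro p hp hnot
  obtain ⟨hp1, hp2⟩ := hp
  have hmax : p.IsMaximal := hp1.isMaximal hp2
  refine ⟨hp1, hp2, ?_, hmax, ?_⟩
  · intro hle
    exact hnot (p.mul_mem_right _ (hle (Ideal.subset_span ⟨i₀, rfl⟩)))
  · intro x hx
    letI : Field ((𝓞 K) ⧸ p) := @Ideal.Quotient.field _ _ p hmax
    funext j
    have hj : c j ∉ p := fun hmem => hnot (p.mul_mem_left _ (by
      rw [← Finset.mul_prod_erase _ _ (Finset.mem_univ j)]
      exact p.mul_mem_right _ hmem))
    have e := congrArg (fun P => MvPolynomial.aeval x (P.map (Ideal.Quotient.mk p))) (hh j)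
    simp only [map_sum, map_mul, MvPolynomial.map_C, map_pow, MvPolynomial.map_X, hx, mul_zero, 
      Finset.sum_const_zero, MvPolynomial.aeval_X, MvPolynomial.aeval_C] at e
    rcases mul_eq_zero.1 e.symm with h1 | h1
    · have h2 : (Ideal.Quotient.mk p) (c j) = 0 := 
        (algebraMap ((𝓞 K) ⧸ p) (AlgebraicClosure ((𝓞 K) ⧸ p))).injective (h1.trans (map_zero _).symm)
      exact absurd (Ideal.Quotient.eq_zero_iff_mem.1 h2) hj
    · exact IsReduced.eq_zero _ ⟨_, h1⟩

lemma finite_primes_mem {c : 𝓞 K} (hc : c ≠ 0) : {p | p ∈ Pset K ∧ c ∈ p}.Finite := by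
  classical
  have hI : Ideal.span {c} ≠ ⊥ := by simpa using hc
  refine (UniqueFactorizationMonoid.normalizedFactors (Ideal.span {c})).toFinset.finite_toSet.subset ?_
  rintro p ⟨hp, hcp⟩
  rw [Finset.mem_coe, Multiset.mem_toFinset, Ideal.mem_normalizedFactors_iff hI]
  exact ⟨hp.1, by simpa [Ideal.span_le] using hcp⟩

end bad

section growth
variable (K : Type) [Field K] [NumberField K] {N : ℕ}

lemma poly_bound (f : 𝓞 K →+* ℂ) {d : ℕ} {P : MvPolynomial (Fin (N+1)) (𝓞 K)} (hP : P.IsHomogeneous d)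
    (b : Fin (N+1) → 𝓞 K) (R : ℝ) (hb : ∀ i, ‖f (b i)‖ ≤ R) : 
    ‖f (MvPolynomial.eval b P)‖ ≤ (∑ m ∈ P.support, ‖f (P.coeff m)‖) * R ^ d := by
  rw [MvPolynomial.eval_eq', map_sum, Finset.sum_mul]
  refine (norm_sum_le _ _).trans (Finset.sum_le_sum fun m hm => ?_)
  rw [map_mul, norm_mul, map_prod, norm_prod]
  gcongr
  have hdeg := hP (MvPolynomial.mem_support_iff.1 hm)
  have : ∑ i, m i = d := by
    rw [← hdeg, Finsupp.weight_apply, Finsupp.sum_fintype] <;> simp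
  rw [← this, ← Finset.prod_pow_eq_pow_sum]
  refine Finset.prod_le_prod (fun _ _ => norm_nonneg _) fun i _ => ?_
  rw [map_pow, norm_pow]
  gcongr
  exact hb i

lemma iter_bound (f : 𝓞 K →+* ℂ) {d : ℕ} (Fp : Fin (N + 1) → MvPolynomial (Fin (N + 1)) (𝓞 K))
    (hhom : ∀ i, (Fp i).IsHomogeneous d) (α : Fin (N + 1) → 𝓞 K) : 
    ∃ A : ℝ, 1 ≤ A ∧ ∀ n i, ‖f (((FmapK K Fp)^[n] α) i)‖ ≤ A ^ ((d+1)^n) := by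
  set A₁ : ℝ := ∑ i, ∑ m ∈ (Fp i).support, ‖f ((Fp i).coeff m)‖ with hA₁
  set A₂ : ℝ := ∑ i, ‖f (α i)‖ with hA₂
  have h1 : 0 ≤ A₁ := by positivity
  have h2 : 0 ≤ A₂ := by positivity
  have hA : 1 ≤ 1 + A₁ + A₂ := by linarith
  refine ⟨1 + A₁ + A₂, hA, ?_⟩
  intro n
  induction n with
  | zero => 
    intro i
    have : ‖f (α i)‖ ≤ A₂ := Finset.single_le_sum (f := fun i => ‖f (α i)‖) (fun _ _ => norm_nonneg _) (Finset.mem_univ i)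
    simp only [Function.iterate_zero, id, pow_zero, pow_one]
    linarith
  | succ n ih =>
    intro i
    rw [Function.iterate_succ_apply']
    have h3 := poly_bound K f (hhom i) _ _ ih
    have h4 : ∑ m ∈ (Fp i).support, ‖f ((Fp i).coeff m)‖ ≤ A₁ := 
      Finset.single_le_sum (f := fun i => ∑ m ∈ (Fp i).support, ‖f ((Fp i).coeff m)‖) 
        (fun _ _ => by positivity) (Finset.mem_univ i)
    refine h3.trans ?_
    set A := 1 + A₁ + A₂
    calc _ ≤ A ^ 1 * (A ^ (d+1)^n) ^ d := by
          gcongr; rw [pow_one]; linarith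
      _ = A ^ (1 + (d+1)^n * d) := by rw [← pow_mul, ← pow_add]
      _ ≤ A ^ ((d+1)^(n+1)) := by
        apply pow_le_pow_right₀ hA
        have : 1 ≤ (d+1)^n := Nat.one_le_pow _ _ (by omega)
        rw [pow_succ]; nlinarith

lemma norm_bound (x : 𝓞 K) (R : ℝ) (h : ∀ σ : K →ₐ[ℚ] ℂ, ‖σ (x : K)‖ ≤ R) :
    (Ideal.absNorm (Ideal.span {x}) : ℝ) ≤ R ^ (Fintype.card (K →ₐ[ℚ] ℂ)) := by
  have h1 : (Ideal.absNorm (Ideal.span {x}) : ℝ) = ‖algebraMap ℚ ℂ (Algebra.norm ℚ (x : K))‖ := by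
    rw [Ideal.absNorm_span_singleton, ← Algebra.coe_norm_int]
    simp [Nat.cast_natAbs]
  rw [h1, Algebra.norm_eq_prod_embeddings, norm_prod, ← Finset.card_univ, ← Finset.prod_const]
  exact Finset.prod_le_prod (fun _ _ => norm_nonneg _) fun σ _ => h σ

lemma minor_bound {d : ℕ} (Fp : Fin (N + 1) → MvPolynomial (Fin (N + 1)) (𝓞 K))
    (hhom : ∀ i, (Fp i).IsHomogeneous d) (α : Fin (N + 1) → 𝓞 K) : 
    ∃ B : ℝ, 1 ≤ B ∧ ∀ m n i j, m < n → ∀ x : 𝓞 K, 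
     x = ((FmapK K Fp)^[m] α) i * ((FmapK K Fp)^[n] α) j -
        ((FmapK K Fp)^[m] α) j * ((FmapK K Fp)^[n] α) i → x ≠ 0 → 
      Real.log (Ideal.absNorm (Ideal.span {x})) ≤ B * (d+1)^n := by
  choose A' hA' hAb using fun σ : K →ₐ[ℚ] ℂ => 
    iter_bound K ((σ : K →+* ℂ).comp (algebraMap (𝓞 K) K)) Fp hhom α
  set A := 1 + ∑ σ, A' σ with hA
  have hle : ∀ σ, A' σ ≤ A := fun σ => by
    have := Finset.single_le_sum (f := A') (fun σ _ => zero_le_one.trans (hA' σ)) (Finset.mem_univ σ)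
    linarith
  have hA1 : 1 ≤ A := by
    have := Finset.sum_nonneg (s := Finset.univ) (f := A') (fun σ _ => zero_le_one.trans (hA' σ))
    linarith
  have hl : 0 ≤ Real.log A := Real.log_nonneg hA1
  set D := Fintype.card (K →ₐ[ℚ] ℂ) with hD
  refine ⟨1 + D * (1 + 2 * Real.log A), by simp; positivity, ?_⟩
  intro m n i j hmn x hx hx0
  have hb : ∀ (σ : K →ₐ[ℚ] ℂ) (l : ℕ) (i), l ≤ n → ‖σ (((FmapK K Fp)^[l] α) i : K)‖ ≤ A ^ ((d+1)^n) := by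
    intro σ l i hl
    calc _ ≤ A' σ ^ ((d+1)^l) := hAb σ l i
      _ ≤ A ^ ((d+1)^l) := by
        have := hA' σ
        gcongr
        exact hle σ
      _ ≤ _ := pow_le_pow_right₀ hA1 (Nat.pow_le_pow_right (by omega) hl)
  have hN := norm_bound K x (2 * (A ^ ((d+1)^n)) ^ 2) (fun σ => by
    rw [hx]
    push_cast
    simp only [map_sub, map_mul]
    refine (norm_sub_le _ _).trans ?_
    rw [norm_mul, norm_mul, two_mul, sq]
    gcongr <;> apply hb <;> omega)
  have hpos : (0:ℝ) < Ideal.absNorm (Ideal.span {x}) := by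
    rw [Nat.cast_pos, Nat.pos_iff_ne_zero, Ne, Ideal.absNorm_eq_zero_iff]
    simpa using hx0
  have h1 := Real.log_le_log hpos hN
  rw [Real.log_pow, Real.log_mul (by norm_num) (by positivity), Real.log_pow, Real.log_pow] at h1
  refine h1.trans ?_
  push_cast
  rw [← hD]
  have h2 : Real.log 2 ≤ 1 := by linarith [Real.log_two_lt_d9]
  have h3 : (1:ℝ) ≤ (d+1)^n := one_le_pow₀ (by linarith [(Nat.cast_nonneg d : (0:ℝ) ≤ d)])
  set q : ℝ := (d+1)^n
  have h4 : Real.log 2 + 2 * (q * Real.log A) ≤ (1 + 2 * Real.log A) * q := by nlinarith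
  calc (D:ℝ) * (Real.log 2 + 2 * (q * Real.log A)) ≤ D * ((1 + 2 * Real.log A) * q) := by gcongr
    _ ≤ _ := by nlinarith

end growth

section orbit
variable (K : Type) [Field K] [NumberField K] {N : ℕ}

lemma orbit_pos (Fp : Fin (N + 1) → MvPolynomial (Fin (N + 1)) (𝓞 K)) (α : Fin (N + 1) → 𝓞 K)
    {p : Ideal (𝓞 K)} (hp : p ∈ Pset K) : 1 ≤ orbitLenK K Fp α p := by
  have : Finite ((𝓞 K) ⧸ p) := Ideal.finiteQuotientOfFreeOfNeBot p hp.2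
  rw [orbitLenK, Nat.one_le_iff_ne_zero, Ne, Set.ncard_eq_zero (Set.toFinite _)]
  exact (Set.range_nonempty _).ne_empty

lemma collision (Fp : Fin (N + 1) → MvPolynomial (Fin (N + 1)) (𝓞 K)) (α : Fin (N + 1) → 𝓞 K)
    {p : Ideal (𝓞 K)} (hp : p ∈ Pset K) {n : ℕ} (hn : orbitLenK K Fp α p ≤ n) :
    ∃ a b : ℕ, a < b ∧ b ≤ n ∧ ∀ i j, ((FmapK K Fp)^[a] α) i * ((FmapK K Fp)^[b] α) j -
        ((FmapK K Fp)^[a] α) j * ((FmapK K Fp)^[b] α) i ∈ p := by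
  have hfin : Finite ((𝓞 K) ⧸ p) := Ideal.finiteQuotientOfFreeOfNeBot p hp.2
  set f : ℕ → Quotient (MulAction.orbitRel ((𝓞 K) ⧸ p)ˣ (Fin (N + 1) → (𝓞 K) ⧸ p)) := fun n : ℕ =>
    Quotient.mk (MulAction.orbitRel ((𝓞 K) ⧸ p)ˣ (Fin (N + 1) → (𝓞 K) ⧸ p))
      (fun i => Ideal.Quotient.mk p (((FmapK K Fp)^[n] α) i)) with hf
  have hn' : (Set.range f).ncard ≤ n := hn
  have h1 : ∃ a ∈ Finset.range (n+1), ∃ b ∈ Finset.range (n+1), a ≠ b ∧ f a = f b := by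
    have hfr : (Set.range f).Finite := Set.toFinite _
    apply Finset.exists_ne_map_eq_of_card_lt_of_maps_to (t := hfr.toFinset)
    · rw [Finset.card_range, ← Set.ncard_eq_toFinset_card _ hfr]; omega
    · intro a _
      simp
  have h2 : ∃ a b : ℕ, a < b ∧ b ≤ n ∧ f a = f b := by
    obtain ⟨a, ha, b, hb, hab, h⟩ := h1
    rw [Finset.mem_range] at ha hb
    rcases lt_or_gt_of_ne hab with h' | h'
    · exact ⟨a, b, h', by omega, h⟩
    · exact ⟨b, a, h', by omega, h.symm⟩
  obtain ⟨a, b, hab, hbn, h⟩ := h2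
  refine ⟨a, b, hab, hbn, fun i j => ?_⟩
  have h3 := Quotient.exact h
  rw [← Quotient.eq_iff_equiv, Quotient.eq, MulAction.orbitRel_apply] at h3
  obtain ⟨u, hu⟩ := h3
  have hu' : ∀ i, (u : (𝓞 K) ⧸ p) * Ideal.Quotient.mk p (((FmapK K Fp)^[b] α) i) = 
     Ideal.Quotient.mk p (((FmapK K Fp)^[a] α) i) := fun i => congrFun hu i
  rw [← Ideal.Quotient.eq_zero_iff_mem, map_sub, map_mul, map_mul, ← hu' i, ← hu' j]
  ring

variable {K} in
lemma sum_log_le {I : Ideal (𝓞 K)} (hI : I ≠ ⊥) (F : Finset (Ideal (𝓞 K))) (hF : ∀ p ∈ F, p ∈ Pset K)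
    (hdvd : ∀ p ∈ F, p ∣ I) : ∑ p ∈ F, Real.log (Ideal.absNorm p) ≤ Real.log (Ideal.absNorm I) := by
  have h := Finset.prod_primes_dvd I (fun p hp => Pset.prime (hF p hp)) hdvd
  rw [← Real.log_prod (fun p hp => by
    have := Pset.two_le (hF p hp); positivity)]
  have h2 : ∏ p ∈ F, Ideal.absNorm p ≤ Ideal.absNorm I := by
    rw [← map_prod]
    refine Nat.le_of_dvd (Nat.pos_of_ne_zero ?_) (map_dvd Ideal.absNorm h)
    rw [Ne, Ideal.absNorm_eq_zero_iff]; exact hI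
  rw [← Nat.cast_prod]
  apply Real.log_le_log
  · rw [Nat.cast_pos]
    exact Finset.prod_pos fun p hp => by have := Pset.two_le (hF p hp); omega
  · exact_mod_cast h2

lemma sum_log_bound {d : ℕ} (Fp : Fin (N + 1) → MvPolynomial (Fin (N + 1)) (𝓞 K))
    (hhom : ∀ i, (Fp i).IsHomogeneous d) (α : Fin (N + 1) → 𝓞 K) 
    (horbit : ∀ m n : ℕ, m < n → ∃ i j : Fin (N + 1),
      ((FmapK K Fp)^[m] α) i * ((FmapK K Fp)^[n] α) j ≠
        ((FmapK K Fp)^[m] α) j * ((FmapK K Fp)^[n] α) i) : 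
    ∃ B : ℝ, 1 ≤ B ∧ ∀ n : ℕ, 1 ≤ n → ∀ F : Finset (Ideal (𝓞 K)), (∀ p ∈ F, p ∈ Pset K) → 
      (∀ p ∈ F, orbitLenK K Fp α p ≤ n) → ∑ p ∈ F, Real.log (Ideal.absNorm p) ≤ B ^ n := by
  obtain ⟨B, hB, hbound⟩ := minor_bound K Fp hhom α
  choose! i j hij using horbit
  set x : ℕ × ℕ → 𝓞 K := fun ab => ((FmapK K Fp)^[ab.1] α) (i ab.1 ab.2) * ((FmapK K Fp)^[ab.2] α) (j ab.1 ab.2) -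
        ((FmapK K Fp)^[ab.1] α) (j ab.1 ab.2) * ((FmapK K Fp)^[ab.2] α) (i ab.1 ab.2) with hx
  refine ⟨4 * B * (d+1), ?_, ?_⟩
  · have : (0:ℝ) ≤ d := by positivity
    nlinarith
  intro n hn F hF hm
  set S : Finset (ℕ × ℕ) := (Finset.range (n+1) ×ˢ Finset.range (n+1)).filter (fun ab => ab.1 < ab.2) with hS
  have hne : ∀ ab ∈ S, x ab ≠ 0 := by
    intro ab hab
    rw [hS, Finset.mem_filter] at hab
    exact sub_ne_zero.2 (hij _ _ hab.2)
  have hneI : ∀ ab ∈ S, Ideal.span {x ab} ≠ ⊥ := by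
    intro ab hab; simpa using hne ab hab
  have hprod : ∏ ab ∈ S, Ideal.span {x ab} ≠ ⊥ := by
    rw [← Ideal.zero_eq_bot, Finset.prod_ne_zero_iff]
    exact fun ab hab => hneI ab hab
  have h1 := sum_log_le hprod F hF (fun p hp => by
    obtain ⟨a, b, hab, hbn, h⟩ := collision K Fp α (hF p hp) (hm p hp)
    have hmem : (a, b) ∈ S := by
      rw [hS, Finset.mem_filter, Finset.mem_product, Finset.mem_range, Finset.mem_range]
      refine ⟨⟨?_, ?_⟩, hab⟩ <;> simp only <;> omega
    refine dvd_trans ?_ (Finset.dvd_prod_of_mem _ hmem)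
    rw [Ideal.dvd_span_singleton]
    exact h _ _)
  refine h1.trans ?_
  rw [map_prod, Nat.cast_prod, Real.log_prod (fun ab hab => by
    rw [Nat.cast_ne_zero, Ne, Ideal.absNorm_eq_zero_iff]; exact hneI ab hab)]
  have hd1 : (1:ℝ) ≤ d + 1 := by linarith [(Nat.cast_nonneg d : (0:ℝ) ≤ d)]
  have h2 : ∀ ab ∈ S, Real.log (Ideal.absNorm (Ideal.span {x ab})) ≤ B * (d+1)^n := by
    intro ab hab
    have hab' := hab
    rw [hS, Finset.mem_filter, Finset.mem_product, Finset.mem_range, Finset.mem_range] at hab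
    refine (hbound ab.1 ab.2 _ _ hab.2 (x ab) rfl (hne ab hab')).trans ?_
    have : ab.2 ≤ n := by omega
    gcongr
  have h3 : (S.card : ℝ) ≤ 4 ^ n := by
    have : S.card ≤ (n+1) * (n+1) := by
      refine (Finset.card_filter_le _ _).trans ?_
      simp
    have h4 : n + 1 ≤ 2 ^ n := Nat.lt_two_pow_self
    have h5 : S.card ≤ 4 ^ n := by
      calc S.card ≤ (n+1) * (n+1) := this
        _ ≤ 2 ^ n * 2 ^ n := by gcongr
        _ = 4 ^ n := by rw [← mul_pow]; norm_num
    exact_mod_cast h5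
  calc _ ≤ ∑ ab ∈ S, B * ((d:ℝ)+1)^n := Finset.sum_le_sum h2
    _ = S.card * (B * ((d:ℝ)+1)^n) := by rw [Finset.sum_const, nsmul_eq_mul]
    _ ≤ 4 ^ n * (B ^ n * ((d:ℝ)+1)^n) := by
      have : B ≤ B ^ n := le_self_pow₀ hB (by omega)
      gcongr
    _ = _ := by rw [mul_pow, mul_pow]; ring

lemma mertens : ∃ M L₀ : ℝ, 0 < M ∧ 0 < L₀ ∧ ∀ L : ℝ, L₀ ≤ L → ∀ n : ℕ, 1 ≤ n → 
    ∀ F : Finset (Ideal (𝓞 K)), (∀ p ∈ F, p ∈ Pset K) → 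
    ∑ p ∈ F, Real.log (Ideal.absNorm p) ≤ Real.exp (n * L) → 
    ∑ p ∈ F, wt K 1 p ≤ (M * L + 1) * n := by
  classical
  obtain ⟨M, hM, s₀, hs₀, hT⟩ := Tt_bdd K
  refine ⟨Real.exp 1 * M, 2 / (s₀ - 1), by positivity, div_pos two_pos (by linarith), ?_⟩
  intro L hL n hn F hF hsum
  have hs0' : 0 < s₀ - 1 := by linarith
  have hL0 : 0 < L := lt_of_lt_of_le (by positivity) hL
  have hn' : (1:ℝ) ≤ n := by exact_mod_cast hn
  have hnL : 0 < n * L := by positivity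
  rw [div_le_iff₀ hs0'] at hL
  have hT1 := hT (1 + 1 / (n * L)) (by simp; positivity) (by
    have : 1 / (n * L) < s₀ - 1 := by
      rw [div_lt_iff₀ hnL]; nlinarith
    linarith)
  set s := 1 + 1 / (n * L) with hs
  have hs1 : 1 < s := by rw [hs]; simp; positivity
  have hT2 : Tt K s ≤ M * (n * L) := by
    have : s - 1 = 1 / (n * L) := by rw [hs]; ring
    rw [this, div_mul_eq_mul_div, one_mul, div_le_iff₀ hnL] at hT1
    exact hT1
  rw [← Finset.sum_filter_add_sum_filter_not F (fun p => (Ideal.absNorm p : ℝ) ≤ Real.exp (n * L))]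
  have hA : ∑ p ∈ F with (Ideal.absNorm p : ℝ) ≤ Real.exp (n * L), wt K 1 p ≤ Real.exp 1 * (M * (n * L)) := by
    calc _ ≤ ∑ p ∈ F with (Ideal.absNorm p : ℝ) ≤ Real.exp (n * L), Real.exp 1 * wt K s p := by
          refine Finset.sum_le_sum fun p hp => ?_
          rw [Finset.mem_filter] at hp
          have h2 := Pset.two_le (hF p hp.1)
          have hpos : (0:ℝ) < Ideal.absNorm p := by exact_mod_cast (by omega : 0 < Ideal.absNorm p)
          have hl := Real.log_natCast_nonneg (Ideal.absNorm p)
          rw [wt_eq, wt_eq, mul_left_comm]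
          refine mul_le_mul_of_nonneg_left ?_ hl
          rw [Real.rpow_def_of_pos hpos, Real.rpow_def_of_pos hpos, ← Real.exp_add, Real.exp_le_exp]
          have h3 : Real.log (Ideal.absNorm p) ≤ n * L := (Real.log_le_iff_le_exp hpos).2 hp.2
          have h4 : Real.log (Ideal.absNorm p) * (1 / (n * L)) ≤ 1 := by
            rw [mul_one_div, div_le_one hnL]; exact h3
          rw [hs]; nlinarith
      _ = Real.exp 1 * ∑ p ∈ F with (Ideal.absNorm p : ℝ) ≤ Real.exp (n * L), wt K s p := by
          rw [Finset.mul_sum]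
      _ ≤ Real.exp 1 * Tt K s := by
          gcongr
          have h5 : Tt K s = ∑' p, (Pset K).indicator (wt K s) p := tsum_subtype _ _
          rw [h5]
          have h6 : Summable ((Pset K).indicator (wt K s)) := (wt_summable K hs1).indicator _
          refine le_trans (le_of_eq ?_) (h6.sum_le_tsum (F.filter (fun p => (Ideal.absNorm p : ℝ) ≤ Real.exp (n * L))) 
            (fun p _ => Set.indicator_nonneg (fun p _ => wt_nonneg K s p) p))
          refine Finset.sum_congr rfl fun p hp => ?_
          rw [Set.indicator_of_mem (hF p (Finset.mem_filter.1 hp).1)]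
      _ ≤ _ := by gcongr
  have hB : ∑ p ∈ F with ¬ (Ideal.absNorm p : ℝ) ≤ Real.exp (n * L), wt K 1 p ≤ 1 := by
    calc _ ≤ ∑ p ∈ F with ¬ (Ideal.absNorm p : ℝ) ≤ Real.exp (n * L), 
            Real.log (Ideal.absNorm p) / Real.exp (n * L) := by
          refine Finset.sum_le_sum fun p hp => ?_
          rw [Finset.mem_filter, not_le] at hp
          have hl := Real.log_natCast_nonneg (Ideal.absNorm p)
          rw [wt, Real.rpow_one]
          gcongr
          exact hp.2.le
      _ ≤ ∑ p ∈ F, Real.log (Ideal.absNorm p) / Real.exp (n * L) := by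
          refine Finset.sum_le_sum_of_subset_of_nonneg (Finset.filter_subset _ _) fun p _ _ => ?_
          have hl := Real.log_natCast_nonneg (Ideal.absNorm p)
          positivity
      _ ≤ 1 := by
          rw [← Finset.sum_div, div_le_one (Real.exp_pos _)]; exact hsum
  nlinarith

lemma abel_bound (m : Ideal (𝓞 K) → ℕ) (C : ℝ) 
    (h : ∀ n : ℕ, ∀ F : Finset (Ideal (𝓞 K)), (∀ p ∈ F, p ∈ Pset K) → 
      (∀ p ∈ F, m p ≤ n) → ∑ p ∈ F, wt K 1 p ≤ C * n) (hC : 0 ≤ C)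
    {ε s : ℝ} (hε : 0 < ε) (hs : 1 < s) (F : Finset (Ideal (𝓞 K))) (hF : ∀ p ∈ F, p ∈ Pset K)
    (hm : ∀ p ∈ F, (m p : ℝ) < ε * Real.log (Ideal.absNorm p)) : 
    ∑ p ∈ F, wt K s p ≤ C * ε / (s - 1) := by
  classical
  set lam := (s - 1) / ε with hlam
  have hlam0 : 0 < lam := div_pos (by linarith) hε
  set r := Real.exp (-lam) with hr
  have hr0 : 0 < r := Real.exp_pos _
  have hr1 : r < 1 := by rw [hr, Real.exp_lt_one_iff]; linarith
  have hrn : ‖r‖ < 1 := by rw [Real.norm_eq_abs, abs_of_pos hr0]; exact hr1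
  have h1 : ∀ p ∈ F, wt K s p ≤ wt K 1 p * r ^ (m p) := by
    intro p hp
    have h2 := Pset.two_le (hF p hp)
    have hpos : (0:ℝ) < Ideal.absNorm p := by exact_mod_cast (by omega : 0 < Ideal.absNorm p)
    have hl := Real.log_natCast_nonneg (Ideal.absNorm p)
    rw [wt_eq, wt_eq, mul_assoc]
    refine mul_le_mul_of_nonneg_left ?_ hl
    rw [Real.rpow_def_of_pos hpos, Real.rpow_def_of_pos hpos, hr, ← Real.exp_nat_mul, ← Real.exp_add, Real.exp_le_exp]
    have h3 : m p * lam ≤ (s - 1) * Real.log (Ideal.absNorm p) := by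
      rw [hlam, mul_div_assoc', div_le_iff₀ hε]
      have := (hm p hp).le
      nlinarith
    nlinarith
  -- geometric tails
  have hgeo : ∀ k : ℕ, HasSum (fun n : ℕ => if k ≤ n then (1 - r) * r ^ n else 0) (r ^ k) := by
    intro k
    have hg := (hasSum_geometric_of_lt_one hr0.le hr1).mul_left ((1 - r) * r ^ k)
    have e : (1 - r) * r ^ k * (1 - r)⁻¹ = r ^ k := by
      field_simp [(by linarith : (1 - r) ≠ 0)]
    rw [e] at hg
    have hinj : Function.Injective (fun n : ℕ => n + k) := add_left_injective k
    rw [← hinj.hasSum_iff]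
    · refine hg.congr_fun ?_ |> fun h => h
      intro n
      simp [pow_add]; ring
    · intro n hn
      rw [if_neg]
      intro hk
      exact hn ⟨n - k, by simp; omega⟩
  have hsum : HasSum (fun n : ℕ => ∑ p ∈ F, wt K 1 p * (if m p ≤ n then (1 - r) * r ^ n else 0)) 
      (∑ p ∈ F, wt K 1 p * r ^ (m p)) := 
    hasSum_sum fun p _ => (hgeo (m p)).mul_left _
  have hsum2 : HasSum (fun n : ℕ => C * (1 - r) * (n * r ^ n)) (C * (1 - r) * (r / (1 - r) ^ 2)) := 
    (hasSum_coe_mul_geometric_of_norm_lt_one hrn).mul_left _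
  have hle : ∑ p ∈ F, wt K 1 p * r ^ (m p) ≤ C * (1 - r) * (r / (1 - r) ^ 2) := by
    refine hasSum_le (fun n => ?_) hsum hsum2
    have h2 := h n (F.filter (fun p => m p ≤ n)) (fun p hp => hF p (Finset.mem_filter.1 hp).1) 
      (fun p hp => (Finset.mem_filter.1 hp).2)
    have e : ∑ p ∈ F, wt K 1 p * (if m p ≤ n then (1 - r) * r ^ n else 0) = 
      (∑ p ∈ F with m p ≤ n, wt K 1 p) * ((1 - r) * r ^ n) := by
      rw [Finset.sum_mul, Finset.sum_filter]
      refine Finset.sum_congr rfl fun p _ => ?_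
      split_ifs <;> simp
    rw [e]
    have : 0 ≤ (1 - r) * r ^ n := mul_nonneg (by linarith) (by positivity)
    calc _ ≤ C * n * ((1 - r) * r ^ n) := by gcongr
      _ = _ := by ring
  refine (Finset.sum_le_sum h1).trans (hle.trans ?_)
  have h1r : 0 < 1 - r := by linarith
  have e1 : C * (1 - r) * (r / (1 - r) ^ 2) = C * (r / (1 - r)) := by field_simp
  have e2 : C * ε / (s - 1) = C * (1 / lam) := by rw [hlam]; field_simp
  rw [e1, e2]
  refine mul_le_mul_of_nonneg_left ?_ hC
  rw [div_le_div_iff₀ h1r hlam0, one_mul]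
  have h5 : r * (lam + 1) ≤ 1 := by
    calc r * (lam + 1) ≤ r * Real.exp lam := by gcongr; exact Real.add_one_le_exp _
      _ = 1 := by rw [hr, ← Real.exp_add]; simp
  linarith

end orbit
theorem stmt3 (K : Type) [Field K] [NumberField K] (N d : ℕ) (hN : 1 ≤ N) (hd : 2 ≤ d)
    (Fp : Fin (N + 1) → MvPolynomial (Fin (N + 1)) (𝓞 K))
    (hhom : ∀ i, (Fp i).IsHomogeneous d)
    (hzero : ∀ x : Fin (N + 1) → AlgebraicClosure K,
      (∀ i, MvPolynomial.aeval x ((Fp i).map (algebraMap (𝓞 K) K)) = 0) → x = 0)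
    (α : Fin (N + 1) → 𝓞 K) (hα : α ≠ 0)
    (horbit : ∀ m n : ℕ, m < n → ∃ i j : Fin (N + 1),
      ((FmapK K Fp)^[m] α) i * ((FmapK K Fp)^[n] α) j ≠
        ((FmapK K Fp)^[m] α) j * ((FmapK K Fp)^[n] α) i) :
    ∃ C : ℝ, 0 < C ∧ ∀ ε : ℝ, 0 < ε →
      1 - C * ε ≤ Filter.liminf (fun s : ℝ => (s - 1) *
          ∑' p : {p : Ideal (𝓞 K) // GoodIdeal K Fp α p ∧
              ε * Real.log (Ideal.absNorm p) ≤ (orbitLenK K Fp α p : ℝ)},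
            Real.log (Ideal.absNorm p.1) / (Ideal.absNorm p.1 : ℝ) ^ s)
        (𝓝[>] (1 : ℝ)) := by
  classical
  obtain ⟨c, hc0, hgood⟩ := good_of_notMem K Fp hzero α hα
  obtain ⟨B, hB, hBsum⟩ := sum_log_bound K Fp hhom α horbit
  obtain ⟨M, L₀, hM, hL₀, hmert⟩ := mertens K
  set L := max L₀ (Real.log B) with hL
  have hLpos : 0 < L := lt_of_lt_of_le hL₀ (le_max_left _ _)
  set C := M * L + 1 with hC
  have hCpos : 0 < C := by positivity
  have hg : ∀ n : ℕ, ∀ F : Finset (Ideal (𝓞 K)), (∀ p ∈ F, p ∈ Pset K) →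
      (∀ p ∈ F, orbitLenK K Fp α p ≤ n) → ∑ p ∈ F, wt K 1 p ≤ C * n := by
    intro n F hF hm
    rcases Nat.eq_zero_or_pos n with rfl | hn
    · have : F = ∅ := by
        rw [Finset.eq_empty_iff_forall_notMem]
        intro p hp
        have h1 := hm p hp
        have h2 := orbit_pos K Fp α (hF p hp)
        omega
      simp [this]
    · refine hmert L (le_max_left _ _) n hn F hF ((hBsum n hn F hF hm).trans ?_)
      rw [Real.exp_nat_mul]
      have : B ≤ Real.exp L := by
        rw [← Real.log_le_iff_le_exp (by linarith)]
        exact le_max_right _ _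
      gcongr
  refine ⟨C, hCpos, fun ε hε => ?_⟩
  set S : Set (Ideal (𝓞 K)) := {p | GoodIdeal K Fp α p ∧
              ε * Real.log (Ideal.absNorm p) ≤ (orbitLenK K Fp α p : ℝ)} with hS
  set E : Set (Ideal (𝓞 K)) := {p | p ∈ Pset K ∧
              (orbitLenK K Fp α p : ℝ) < ε * Real.log (Ideal.absNorm p)} with hE
  have hBd := finite_primes_mem K hc0
  set Bd : Set (Ideal (𝓞 K)) := {p | p ∈ Pset K ∧ c ∈ p} with hBdef
  have hu : (fun s : ℝ => (s - 1) *
          ∑' p : {p : Ideal (𝓞 K) // GoodIdeal K Fp α p ∧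
              ε * Real.log (Ideal.absNorm p) ≤ (orbitLenK K Fp α p : ℝ)},
            Real.log (Ideal.absNorm p.1) / (Ideal.absNorm p.1 : ℝ) ^ s) =
        (fun s : ℝ => (s - 1) * ∑' p, S.indicator (wt K s) p) := by
    funext s
    congr 1
    exact tsum_subtype S (wt K s)
  rw [hu]
  have hTt : ∀ s, Tt K s = ∑' p, (Pset K).indicator (wt K s) p := fun s => tsum_subtype _ _
  have hup : ∀ s : ℝ, 1 < s → ∑' p, S.indicator (wt K s) p ≤ Tt K s := by
    intro s hs
    rw [hTt]
    refine ((wt_summable K hs).indicator _).tsum_le_tsum (fun p => ?_) ((wt_summable K hs).indicator _)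
    refine Set.indicator_le_indicator_of_subset (fun p hp => ?_) (fun p => wt_nonneg K s p) p
    exact ⟨hp.1.1, hp.1.2.1⟩
  set c₁ := ∑ p ∈ hBd.toFinset, wt K 1 p with hc₁
  have hlow : ∀ s : ℝ, 1 < s → Tt K s ≤ ∑' p, S.indicator (wt K s) p + C * ε / (s - 1) + c₁ := by
    intro s hs
    have sm : ∀ X : Set (Ideal (𝓞 K)), Summable (X.indicator (wt K s)) :=
      fun X => (wt_summable K hs).indicator X
    have nn : ∀ (X : Set (Ideal (𝓞 K))) p, 0 ≤ X.indicator (wt K s) p :=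
      fun X p => Set.indicator_nonneg (fun p _ => wt_nonneg K s p) p
    have h1 : Tt K s ≤ ∑' p, S.indicator (wt K s) p + ∑' p, E.indicator (wt K s) p +
        ∑' p, Bd.indicator (wt K s) p := by
      rw [hTt, ← (sm S).tsum_add (sm E), ← ((sm S).add (sm E)).tsum_add (sm Bd)]
      refine (sm _).tsum_le_tsum (fun p => ?_) (((sm S).add (sm E)).add (sm Bd))
      have hSp := nn S p
      have hEp := nn E p
      have hBp := nn Bd p
      by_cases hp : p ∈ Pset K
      · rw [Set.indicator_of_mem hp]
        by_cases h1 : c ∈ p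
        · have : p ∈ Bd := ⟨hp, h1⟩
          rw [Set.indicator_of_mem this]
          linarith
        · by_cases h2 : p ∈ E
          · rw [Set.indicator_of_mem h2]
            linarith
          · have : p ∈ S := ⟨hgood p hp h1, not_lt.1 fun h3 => h2 ⟨hp, h3⟩⟩
            rw [Set.indicator_of_mem this]
            linarith
      · rw [Set.indicator_of_notMem hp]
        linarith
    have h2 : ∑' p, E.indicator (wt K s) p ≤ C * ε / (s - 1) := by
      refine Real.tsum_le_of_sum_le (nn E) fun G => ?_
      have h3 := abel_bound K (orbitLenK K Fp α) C hg hCpos.le hε hs (G.filter (· ∈ E))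
        (fun p hp => (Finset.mem_filter.1 hp).2.1) (fun p hp => (Finset.mem_filter.1 hp).2.2)
      refine le_trans (le_of_eq ?_) h3
      rw [Finset.sum_filter]
      exact Finset.sum_congr rfl fun p _ => Set.indicator_apply _ _ _
    have h3 : ∑' p, Bd.indicator (wt K s) p ≤ c₁ := by
      rw [tsum_eq_sum (s := hBd.toFinset)]
      · refine Finset.sum_le_sum fun p hp => ?_
        rw [Set.Finite.mem_toFinset] at hp
        rw [Set.indicator_of_mem hp, wt, wt]
        have h2 : (2:ℝ) ≤ Ideal.absNorm p := by exact_mod_cast Pset.two_le hp.1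
        have hl := Real.log_natCast_nonneg (Ideal.absNorm p)
        have : (Ideal.absNorm p : ℝ) ^ (1:ℝ) ≤ (Ideal.absNorm p : ℝ) ^ s :=
          Real.rpow_le_rpow_of_exponent_le (by linarith) hs.le
        gcongr
      · intro p hp
        rw [Set.Finite.mem_toFinset] at hp
        exact Set.indicator_of_notMem hp _
    linarith
  have hcob : IsCoboundedUnder (· ≥ ·) (𝓝[>] (1:ℝ))
      (fun s : ℝ => (s - 1) * ∑' p, S.indicator (wt K s) p) := by
    apply IsBoundedUnder.isCoboundedUnder_ge
    obtain ⟨M', hM', s₀, hs₀, hT⟩ := Tt_bdd K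
    refine ⟨M', ?_⟩
    rw [eventually_map]
    filter_upwards [self_mem_nhdsWithin, mem_nhdsWithin_of_mem_nhds (gt_mem_nhds hs₀)] with s hs hs'
    have hs1 : 1 < s := hs
    refine le_trans ?_ (hT s hs hs')
    exact mul_le_mul_of_nonneg_left (hup s hs1) (by linarith)
  refine le_of_forall_pos_sub_le fun η hη => ?_
  refine le_liminf_of_le hcob ?_
  have h0 : Tendsto (fun s : ℝ => (s - 1) * c₁) (𝓝[>] 1) (𝓝 0) := by
    refine tendsto_nhdsWithin_of_tendsto_nhds ?_
    have : Continuous (fun s : ℝ => (s - 1) * c₁) := by fun_prop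
    simpa using this.tendsto 1
  filter_upwards [Tt_lower K (η / 2) (by linarith), self_mem_nhdsWithin,
    h0.eventually (gt_mem_nhds (by linarith : (0:ℝ) < η / 2))] with s h1 hs h2
  have hs1 : 0 < s - 1 := sub_pos.2 hs
  have h3 := mul_le_mul_of_nonneg_left (hlow s hs) hs1.le
  have h4 : (s - 1) * (C * ε / (s - 1)) = C * ε := by field_simp
  rw [mul_add, mul_add, h4] at h3
  linarith
end
end
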